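/- arXiv:2005.10403 — 2 statements merged into one kernel-verified Lean document; each statement's English description precedes it below -/
import Mathlib

section
/- Let b > 0, ℓ > −1/2 and 0 ≤ μ < 1/2. Then there exist constants c_μ > 0 and C > 0, depending only on ℓ, μ and b, with the following property. Let q₁, q₂ : (0, b] → ℂ be measurable with ∫_0^b x^μ |q_i(x)| dx < ∞ for i = 1, 2. Suppose y₁, y₂ : ℝ × (0, b] → ℂ are such that ω ↦ y_i(ω, x) is measurable for each x, and for every ω ∈ ℝ the function y_i(ω, ·) is twice differentiable on (0, b] and satisfies −∂²_x y_i(ω, x) + (ℓ(ℓ+1)/x²) y_i(ω, x) + q_i(x) y_i(ω, x) = ω² y_i(ω, x) on (0, b], together with the normalization lim_{x→0+} y_i(ω, x)/x^{ℓ+1} = √π |ω|^{ℓ+1}/(2^{ℓ+1} Γ(ℓ+3/2)) for ω ≠ 0. Then for every x ∈ (0, b]: ( ∫_ℝ |y₁(ω, x) − y₂(ω, x)|² dω )^{1/2} ≤ c_μ · C(q₁, x) · C(q₂, x) · ∫_0^x t^μ |q₁(t) − q₂(t)| dt, where C(q, x) := C · exp( (C/b) ∫_0^x t |q(t)| dt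 ). -/
open MeasureTheory Set Filter

theorem dist_exp_neg_le {u v : ℝ} (hu : 0 ≤ u) (hv : 0 ≤ v) :
    dist (Real.exp (-u)) (Real.exp (-v)) ≤ dist u v := by
  wlog huv : u ≤ v generalizing u v
  · rw [dist_comm, dist_comm u]
    exact this hv hu (le_of_not_ge huv)
  rw [Real.dist_eq, Real.dist_eq, abs_sub_comm u v, abs_of_nonneg (sub_nonneg.2 huv),
    abs_of_nonneg (sub_nonneg.2 (Real.exp_le_exp.2 (neg_le_neg huv)))]
  have h1 : Real.exp (-v) = Real.exp (-u) * Real.exp (-(v - u)) := by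
    rw [← Real.exp_add]; ring_nf
  have h2 := Real.add_one_le_exp (-(v - u))
  have h3 : Real.exp (-u) ≤ 1 := Real.exp_le_one_iff.2 (by linarith)
  have h4 := Real.exp_pos (-u)
  rw [h1]
  nlinarith

theorem gronwall_integral {k φ : ℝ → ℝ} {a x₀ x₁ : ℝ} (h01 : x₀ ≤ x₁)
    (hk : IntervalIntegrable k volume x₀ x₁)
    (hkφ : IntervalIntegrable (fun t => k t * φ t) volume x₀ x₁)
    (hk0 : ∀ t ∈ Ioc x₀ x₁, 0 ≤ k t)
    (hφ : ∀ t ∈ Ioc x₀ x₁, φ t ≤ a + ∫ s in x₀..t, k s * φ s) :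
    a + ∫ s in x₀..x₁, k s * φ s ≤ a * Real.exp (∫ s in x₀..x₁, k s) := by
  set K : ℝ → ℝ := fun t => ∫ s in x₀..t, k s with hK
  set Φ : ℝ → ℝ := fun t => a + ∫ s in x₀..t, k s * φ s with hΦ
  have hKac : AbsolutelyContinuousOnInterval K x₀ x₁ :=
    hk.absolutelyContinuousOnInterval_intervalIntegral left_mem_uIcc
  have hΦac : AbsolutelyContinuousOnInterval Φ x₀ x₁ := by
    have h1 := hkφ.absolutelyContinuousOnInterval_intervalIntegral (c := x₀) left_mem_uIcc
    have h2 : AbsolutelyContinuousOnInterval (fun _ : ℝ => a) x₀ x₁ :=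
      (LipschitzWith.const (α := ℝ) a).lipschitzOnWith.absolutelyContinuousOnInterval
    exact h2.add h1
  have hK0 : ∀ t ∈ uIcc x₀ x₁, 0 ≤ K t := by
    intro t ht
    rw [uIcc_of_le h01] at ht
    refine intervalIntegral.integral_nonneg_of_ae_restrict ht.1 ?_
    filter_upwards [ae_restrict_mem measurableSet_Icc,
      (Measure.ae_ne (volume.restrict (Icc x₀ t)) x₀)] with s hs hs'
    exact hk0 s ⟨lt_of_le_of_ne hs.1 hs'.symm, hs.2.trans ht.2⟩
  have hEac : AbsolutelyContinuousOnInterval (fun t => Real.exp (-K t)) x₀ x₁ := by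
    rw [absolutelyContinuousOnInterval_iff] at hKac ⊢
    intro ε hε
    obtain ⟨δ, hδ, h⟩ := hKac ε hε
    refine ⟨δ, hδ, fun I hI hlen => (Finset.sum_le_sum fun i hi => ?_).trans_lt (h I hI hlen)⟩
    obtain ⟨h1, h2⟩ := hI.1 i hi
    exact dist_exp_neg_le (hK0 _ h1) (hK0 _ h2)
  have hprod := (hEac.mul hΦac).integral_deriv_eq_sub
  have hle : ∫ x in x₀..x₁, deriv ((fun t => Real.exp (-K t)) * Φ) x ≤ 0 := by
    have : ∫ x in x₀..x₁, deriv ((fun t => Real.exp (-K t)) * Φ) x ≤ ∫ x in x₀..x₁, (0:ℝ) := by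
      refine intervalIntegral.integral_mono_ae_restrict h01
        (hEac.mul hΦac).intervalIntegrable_deriv (by simp) ?_
      filter_upwards [ae_restrict_mem measurableSet_Icc,
        (Measure.ae_ne (volume.restrict (Icc x₀ x₁)) x₀),
        ae_restrict_of_ae hk.ae_hasDerivAt_integral,
        ae_restrict_of_ae hkφ.ae_hasDerivAt_integral] with t ht ht' h1 h2
      have htI : t ∈ uIcc x₀ x₁ := by rwa [uIcc_of_le h01]
      have h1 := h1 htI x₀ left_mem_uIcc
      have h2 := (h2 htI x₀ left_mem_uIcc).const_add a
      have h3 := h1.neg.exp.mul h2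
      have htc : t ∈ Ioc x₀ x₁ := ⟨lt_of_le_of_ne ht.1 ht'.symm, ht.2⟩
      rw [show deriv ((fun t => Real.exp (-K t)) * Φ) t = _ from h3.deriv]
      have h4 := hφ t htc
      have h5 := hk0 t htc
      have : 0 ≤ Real.exp (-K t) * (k t * (Φ t - φ t)) :=
        mul_nonneg (Real.exp_pos _).le (mul_nonneg h5 (sub_nonneg.2 h4))
      simp only [hK, hΦ, Pi.neg_apply] at this ⊢
      linarith
    simpa using this
  rw [hprod] at hle
  have hΦ0 : Φ x₀ = a := by simp [hΦ]
  have hKx : K x₀ = 0 := by simp [hK]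
  simp only [Pi.mul_apply, hΦ0, hKx, neg_zero, Real.exp_zero, one_mul, sub_nonpos] at hle
  have := mul_le_mul_of_nonneg_left hle (Real.exp_pos (K x₁)).le
  rw [← mul_assoc, ← Real.exp_add, add_neg_cancel, Real.exp_zero, one_mul] at this
  rw [mul_comm a]
  exact this

theorem hasDerivAt_regular_coeff {l x : ℝ} {u u' : ℝ → ℂ} {p : ℂ} (hx : 0 < x)
    (hu : HasDerivAt u (u' x) x)
    (hu' : HasDerivAt u' (((l * (l + 1) / x ^ 2 : ℝ) : ℂ) * u x + p) x) :
    HasDerivAt (fun t : ℝ => ((t ^ (-l - 1) : ℝ) : ℂ) * (l * u t + t * u' t))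
      (((x ^ (-l) : ℝ) : ℂ) * p) x := by
  have h1 := (Real.hasDerivAt_rpow_const (p := -l - 1) (Or.inl hx.ne')).ofReal_comp
  have h2 := (hu.const_mul (l : ℂ)).add ((hasDerivAt_id x).ofReal_comp.mul hu')
  have h3 := h1.mul h2
  refine h3.congr_deriv ?_
  have hxc : (x : ℂ) ≠ 0 := by exact_mod_cast hx.ne'
  have e1 : x ^ (-l - 1 - 1) = x ^ (-l) / x / x := by
    rw [Real.rpow_sub_one hx.ne', Real.rpow_sub_one hx.ne']
  have e2 : x ^ (-l - 1) = x ^ (-l) / x := Real.rpow_sub_one hx.ne' _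
  rw [e1, e2]
  simp only [Pi.add_apply, Pi.mul_apply, id]
  push_cast
  field_simp
  ring

theorem hasDerivAt_singular_coeff {l x : ℝ} {u u' : ℝ → ℂ} {p : ℂ} (hx : 0 < x)
    (hu : HasDerivAt u (u' x) x)
    (hu' : HasDerivAt u' (((l * (l + 1) / x ^ 2 : ℝ) : ℂ) * u x + p) x) :
    HasDerivAt (fun t : ℝ => ((t ^ l : ℝ) : ℂ) * ((l + 1) * u t - t * u' t))
      (-(((x ^ (l + 1) : ℝ) : ℂ) * p)) x := by
  have h1 := (Real.hasDerivAt_rpow_const (p := l) (Or.inl hx.ne')).ofReal_comp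
  have h2 := (hu.const_mul (l + 1 : ℂ)).sub ((hasDerivAt_id x).ofReal_comp.mul hu')
  have h3 := h1.mul h2
  refine h3.congr_deriv ?_
  have hxc : (x : ℂ) ≠ 0 := by exact_mod_cast hx.ne'
  have e1 : x ^ (l - 1) = x ^ l / x := Real.rpow_sub_one hx.ne' _
  have e2 : x ^ (l + 1) = x ^ l * x := Real.rpow_add_one hx.ne' _
  rw [e1, e2]
  simp only [Pi.sub_apply, Pi.mul_apply, id]
  push_cast
  field_simp
  ring

/-- Bound an increment by an integral of a bound for the derivative. -/
theorem norm_sub_le_integral_of_norm_deriv_le {f f' : ℝ → ℂ} {g : ℝ → ℝ} {s x : ℝ} (hsx : s ≤ x)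
    (hf : ∀ t ∈ Icc s x, HasDerivAt f (f' t) t)
    (hm : AEStronglyMeasurable f' (volume.restrict (Ioc s x)))
    (hfg : ∀ t ∈ Icc s x, ‖f' t‖ ≤ g t) (hg : IntervalIntegrable g volume s x) :
    ‖f x - f s‖ ≤ ∫ t in s..x, g t := by
  have hint : IntervalIntegrable f' volume s x := by
    rw [intervalIntegrable_iff_integrableOn_Ioc_of_le hsx] at hg ⊢
    refine hg.mono' hm ?_
    filter_upwards [ae_restrict_mem measurableSet_Ioc] with t ht
    exact hfg t (Ioc_subset_Icc_self ht)
  rw [← intervalIntegral.integral_eq_sub_of_hasDerivAt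
    (fun t ht => hf t (by rwa [uIcc_of_le hsx] at ht)) hint]
  exact intervalIntegral.norm_integral_le_of_norm_le hsx
    (Eventually.of_forall fun t ht => hfg t (Ioc_subset_Icc_self ht)) hg

theorem regular_solution_bound {l X : ℝ} {u u' P : ℝ → ℂ} {H : ℝ → ℝ} {c : ℂ}
    (hl : -(1 / 2 : ℝ) < l) (hX : 0 < X)
    (hu : ∀ x ∈ Ioc 0 X, HasDerivAt u (u' x) x)
    (hu' : ∀ x ∈ Ioc 0 X, HasDerivAt u' (((l * (l + 1) / x ^ 2 : ℝ) : ℂ) * u x + P x) x)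
    (hPm : AEStronglyMeasurable P (volume.restrict (Ioc 0 X)))
    (hP : ∀ x ∈ Ioc 0 X, ‖P x‖ ≤ x ^ (l + 1) * H x)
    (hH : IntervalIntegrable (fun t => t * H t) volume 0 X)
    (hc : Tendsto (fun x : ℝ => u x / ((x ^ (l + 1) : ℝ) : ℂ)) (nhdsWithin 0 (Ioi 0)) (nhds c)) :
    ‖u X‖ ≤ X ^ (l + 1) * (‖c‖ + 3 / (2 * l + 1) * ∫ t in (0 : ℝ)..X, t * H t) ∧
    X * ‖u' X‖ ≤
      (l + 1) * X ^ (l + 1) * (‖c‖ + 3 / (2 * l + 1) * ∫ t in (0 : ℝ)..X, t * H t) := by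
  have hβ : 0 < 2 * l + 1 := by linarith
  set I : ℝ := ∫ t in (0 : ℝ)..X, t * H t with hI
  set A : ℝ → ℂ := fun t => ((t ^ (-l - 1) : ℝ) : ℂ) * (l * u t + t * u' t) with hA
  set B : ℝ → ℂ := fun t => ((t ^ l : ℝ) : ℂ) * ((l + 1) * u t - t * u' t) with hB
  have hH0 : ∀ t ∈ Ioc 0 X, 0 ≤ t * H t := fun t ht => by
    have h1 := (norm_nonneg _).trans (hP t ht)
    exact mul_nonneg ht.1.le (nonneg_of_mul_nonneg_right h1 (Real.rpow_pos_of_pos ht.1 _))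
  have hHsub : ∀ s x, 0 < s → s ≤ x → x ≤ X →
      IntervalIntegrable (fun t => t * H t) volume s x := fun s x hs hsx hx =>
    hH.mono_set (by rw [uIcc_of_le hsx, uIcc_of_le hX.le]; exact Icc_subset_Icc hs.le hx)
  have hIsub : ∀ s x, 0 < s → s ≤ x → x ≤ X → ∫ t in s..x, t * H t ≤ I := by
    intro s x hs hsx hx
    refine intervalIntegral.integral_mono_interval hs.le hsx hx ?_ hH
    filter_upwards [ae_restrict_mem measurableSet_Ioc] with t ht using hH0 t ht
  have hmeas : ∀ p s x : ℝ, 0 < s → s ≤ x → x ≤ X → AEStronglyMeasurable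
      (fun t : ℝ => ((t ^ p : ℝ) : ℂ) * P t) (volume.restrict (Ioc s x)) := by
    intro p s x hs hsx hx
    refine AEStronglyMeasurable.mul ?_
      (hPm.mono_measure (Measure.restrict_mono (Ioc_subset_Ioc hs.le hx) le_rfl))
    exact (by fun_prop : Measurable fun t : ℝ => ((t ^ p : ℝ) : ℂ)).aestronglyMeasurable
  have hAinc : ∀ s x, 0 < s → s ≤ x → x ≤ X → ‖A x - A s‖ ≤ I := by
    intro s x hs hsx hx
    refine (norm_sub_le_integral_of_norm_deriv_le hsx (g := fun t => t * H t)
      (f' := fun t => ((t ^ (-l) : ℝ) : ℂ) * P t) ?_ (hmeas _ s x hs hsx hx) ?_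
      (hHsub s x hs hsx hx)).trans (hIsub s x hs hsx hx)
    · intro t ht
      have htX : t ∈ Ioc 0 X := ⟨hs.trans_le ht.1, ht.2.trans hx⟩
      exact hasDerivAt_regular_coeff htX.1 (hu t htX) (hu' t htX)
    · intro t ht
      have htX : t ∈ Ioc 0 X := ⟨hs.trans_le ht.1, ht.2.trans hx⟩
      have hp := Real.rpow_pos_of_pos htX.1 (-l)
      rw [norm_mul, Complex.norm_real, Real.norm_of_nonneg hp.le]
      refine (mul_le_mul_of_nonneg_left (hP t htX) hp.le).trans_eq ?_
      rw [← mul_assoc, ← Real.rpow_add htX.1]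
      simp
  have hBinc : ∀ s x, 0 < s → s ≤ x → x ≤ X → ‖B x - B s‖ ≤ x ^ (2 * l + 1) * I := by
    intro s x hs hsx hx
    have h0 : 0 ≤ x ^ (2 * l + 1) := Real.rpow_nonneg (hs.le.trans hsx) _
    refine (norm_sub_le_integral_of_norm_deriv_le hsx (g := fun t => x ^ (2 * l + 1) * (t * H t))
      (f' := fun t => -(((t ^ (l + 1) : ℝ) : ℂ) * P t)) ?_ (hmeas _ s x hs hsx hx).neg ?_
      ((hHsub s x hs hsx hx).const_mul _)).trans ?_
    · intro t ht
      have htX : t ∈ Ioc 0 X := ⟨hs.trans_le ht.1, ht.2.trans hx⟩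
      exact hasDerivAt_singular_coeff htX.1 (hu t htX) (hu' t htX)
    · intro t ht
      have htX : t ∈ Ioc 0 X := ⟨hs.trans_le ht.1, ht.2.trans hx⟩
      have hp := Real.rpow_pos_of_pos htX.1 (l + 1)
      rw [norm_neg, norm_mul, Complex.norm_real, Real.norm_of_nonneg hp.le]
      refine (mul_le_mul_of_nonneg_left (hP t htX) hp.le).trans ?_
      have e : t ^ (l + 1) * (t ^ (l + 1) * H t) = t ^ (2 * l + 1) * (t * H t) := by
        rw [← mul_assoc, ← Real.rpow_add htX.1, ← mul_assoc, ← Real.rpow_add_one htX.1.ne']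
        ring_nf
      rw [e]
      exact mul_le_mul_of_nonneg_right (Real.rpow_le_rpow htX.1.le ht.2 hβ.le) (hH0 t htX)
    · rw [intervalIntegral.integral_const_mul]
      exact mul_le_mul_of_nonneg_left (hIsub s x hs hsx hx) h0
  have hdec : ∀ t : ℝ, 0 < t → (2 * l + 1 : ℂ) * (u t / ((t ^ (l + 1) : ℝ) : ℂ)) =
      A t + B t / ((t ^ (2 * l + 1) : ℝ) : ℂ) := by
    intro t ht
    have e1 : t ^ (2 * l + 1) = t ^ l * t ^ l * t := by
      rw [Real.rpow_add_one ht.ne', two_mul, Real.rpow_add ht]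
    have e2 : t ^ (-l - 1) = (t ^ l)⁻¹ / t := by
      rw [Real.rpow_sub_one ht.ne', Real.rpow_neg ht.le]
    have e3 : t ^ (l + 1) = t ^ l * t := Real.rpow_add_one ht.ne' _
    have h1 : ((t ^ l : ℝ) : ℂ) ≠ 0 := by exact_mod_cast (Real.rpow_pos_of_pos ht l).ne'
    have h2 : (t : ℂ) ≠ 0 := by exact_mod_cast ht.ne'
    simp only [hA, hB, e1, e2, e3]
    push_cast
    field_simp
    ring
  have hdec' : (2 * l + 1 : ℂ) * (X * u' X) = ((X ^ (l + 1) : ℝ) : ℂ) *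
      ((l + 1) * A X - l * (B X / ((X ^ (2 * l + 1) : ℝ) : ℂ))) := by
    have e1 : X ^ (2 * l + 1) = X ^ l * X ^ l * X := by
      rw [Real.rpow_add_one hX.ne', two_mul, Real.rpow_add hX]
    have e2 : X ^ (-l - 1) = (X ^ l)⁻¹ / X := by
      rw [Real.rpow_sub_one hX.ne', Real.rpow_neg hX.le]
    have e3 : X ^ (l + 1) = X ^ l * X := Real.rpow_add_one hX.ne' _
    have h1 : ((X ^ l : ℝ) : ℂ) ≠ 0 := by exact_mod_cast (Real.rpow_pos_of_pos hX l).ne'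
    have h2 : (X : ℂ) ≠ 0 := by exact_mod_cast hX.ne'
    simp only [hA, hB, e1, e2, e3]
    push_cast
    field_simp
    ring
  have hev : ∀ x, 0 < x → ∀ᶠ s in nhdsWithin (0 : ℝ) (Ioi 0), 0 < s ∧ s < x := fun x hx =>
    Ioo_mem_nhdsGT hx
  have hpow0 : Tendsto (fun t : ℝ => ((t ^ (2 * l + 1) : ℝ) : ℂ)) (nhdsWithin 0 (Ioi 0))
      (nhds 0) := by
    have h1 : Tendsto (fun t : ℝ => t ^ (2 * l + 1)) (nhdsWithin 0 (Ioi 0)) (nhds 0) := by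
      have := (Real.continuous_rpow_const hβ.le).tendsto 0
      rw [Real.zero_rpow hβ.ne'] at this
      exact this.mono_left nhdsWithin_le_nhds
    exact_mod_cast (Complex.continuous_ofReal.tendsto 0).comp h1
  have hB0 : Tendsto B (nhdsWithin 0 (Ioi 0)) (nhds 0) := by
    have h1 : Tendsto (fun t : ℝ => (2 * l + 1 : ℂ) * (u t / ((t ^ (l + 1) : ℝ) : ℂ)))
      (nhdsWithin 0 (Ioi 0)) (nhds ((2 * l + 1 : ℂ) * c)) := hc.const_mul _
    have h2 : Tendsto (fun t : ℝ => ((t ^ (2 * l + 1) : ℝ) : ℂ) * A t)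
        (nhdsWithin 0 (Ioi 0)) (nhds 0) := by
      refine hpow0.zero_mul_isBoundedUnder_le ?_
      refine isBoundedUnder_of_eventually_le (a := ‖A X‖ + I) ?_
      filter_upwards [hev X hX] with s hs
      have h3 := hAinc s X hs.1 hs.2.le le_rfl
      have h4 := norm_le_insert (A X) (A s)
      simp only [Function.comp_apply]
      linarith
    have h3 := (hpow0.mul h1).sub h2
    rw [zero_mul, sub_zero] at h3
    refine h3.congr' ?_
    filter_upwards [hev X hX] with s hs
    have h1 : ((s ^ (2 * l + 1) : ℝ) : ℂ) ≠ 0 := by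
      exact_mod_cast (Real.rpow_pos_of_pos hs.1 _).ne'
    rw [hdec s hs.1]
    field_simp
    ring
  have hBbd : ∀ x, 0 < x → x ≤ X → ‖B x / ((x ^ (2 * l + 1) : ℝ) : ℂ)‖ ≤ I := by
    intro x hx hxX
    have hp := Real.rpow_pos_of_pos hx (2 * l + 1)
    rw [norm_div, Complex.norm_real, Real.norm_of_nonneg hp.le, div_le_iff₀ hp, mul_comm]
    have h1 : Tendsto (fun s => ‖B x - B s‖) (nhdsWithin 0 (Ioi 0)) (nhds ‖B x - 0‖) :=
      (tendsto_const_nhds.sub hB0).norm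
    rw [sub_zero] at h1
    refine le_of_tendsto h1 ?_
    filter_upwards [hev x hx] with s hs using hBinc s x hs.1 hs.2.le hxX
  have hcβ : ‖(2 * l + 1 : ℂ)‖ = 2 * l + 1 := by
    have : (2 * l + 1 : ℂ) = ((2 * l + 1 : ℝ) : ℂ) := by push_cast; rfl
    rw [this, Complex.norm_real, Real.norm_of_nonneg hβ.le]
  have hAbd : ‖A X‖ ≤ (2 * l + 1) * ‖c‖ + 2 * I := by
    have h1 : Tendsto (fun s : ℝ => ‖(2 * l + 1 : ℂ) * (u s / ((s ^ (l + 1) : ℝ) : ℂ))‖ + 2 * I)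
        (nhdsWithin 0 (Ioi 0)) (nhds (‖(2 * l + 1 : ℂ) * c‖ + 2 * I)) :=
      (hc.const_mul _).norm.add_const _
    rw [norm_mul, hcβ] at h1
    refine ge_of_tendsto h1 ?_
    filter_upwards [hev X hX] with s hs
    have h2 := hAinc s X hs.1 hs.2.le le_rfl
    have h3 := hBbd s hs.1 hs.2.le
    rw [hdec s hs.1]
    have h4 : A X = (A X - A s) + (A s + B s / ((s ^ (2 * l + 1) : ℝ) : ℂ)) -
      B s / ((s ^ (2 * l + 1) : ℝ) : ℂ) := by ring
    calc ‖A X‖ ≤ ‖A X - A s‖ + ‖A s + B s / ((s ^ (2 * l + 1) : ℝ) : ℂ)‖ +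
          ‖B s / ((s ^ (2 * l + 1) : ℝ) : ℂ)‖ := by
            conv_lhs => rw [h4]
            exact (norm_sub_le _ _).trans (add_le_add_left (norm_add_le _ _) _)
      _ ≤ _ := by linarith
  have hBX := hBbd X hX le_rfl
  have hI0 : 0 ≤ I := (norm_nonneg _).trans hBX
  have hXp := Real.rpow_pos_of_pos hX (l + 1)
  have hrhs : (2 * l + 1) * (‖c‖ + 3 / (2 * l + 1) * I) = (2 * l + 1) * ‖c‖ + 3 * I := by
    field_simp
  constructor
  · have h1 := congrArg norm (hdec X hX)
    rw [norm_mul, hcβ, norm_div, Complex.norm_real, Real.norm_of_nonneg hXp.le] at h1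
    have h2 : (2 * l + 1) * (‖u X‖ / X ^ (l + 1)) ≤
        (2 * l + 1) * (‖c‖ + 3 / (2 * l + 1) * I) := by
      rw [h1, hrhs]
      exact (norm_add_le _ _).trans (by linarith)
    have h3 := le_of_mul_le_mul_left h2 hβ
    rw [div_le_iff₀ hXp] at h3
    linarith
  · have h1 := congrArg norm hdec'
    rw [norm_mul, hcβ, norm_mul, norm_mul, Complex.norm_real, Complex.norm_real,
      Real.norm_of_nonneg hX.le, Real.norm_of_nonneg hXp.le] at h1
    have hl1 : ‖(l + 1 : ℂ)‖ = l + 1 := by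
      have : (l + 1 : ℂ) = ((l + 1 : ℝ) : ℂ) := by push_cast; rfl
      rw [this, Complex.norm_real, Real.norm_of_nonneg (by linarith)]
    have hl2 : ‖(l : ℂ)‖ ≤ l + 1 := by
      rw [Complex.norm_real, Real.norm_eq_abs, abs_le]; constructor <;> linarith
    have h2 : ‖(l + 1 : ℂ) * A X - l * (B X / ((X ^ (2 * l + 1) : ℝ) : ℂ))‖ ≤
        (l + 1) * ((2 * l + 1) * (‖c‖ + 3 / (2 * l + 1) * I)) := by
      rw [hrhs]
      refine (norm_sub_le _ _).trans ?_
      have h5 := mul_le_mul hl2 hBX (norm_nonneg _) (by linarith)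
      rw [← norm_mul] at h5
      have h6 := mul_le_mul_of_nonneg_left hAbd (by linarith : 0 ≤ l + 1)
      rw [norm_mul (l + 1 : ℂ) (A X), hl1]
      linarith
    have h3 := mul_le_mul_of_nonneg_left h2 hXp.le
    rw [← h1] at h3
    refine le_of_mul_le_mul_left (h3.trans_eq ?_) hβ
    ring

theorem oscillatory_solution_bound {ω x₀ X : ℝ} {u u' F : ℝ → ℂ} {G : ℝ → ℝ}
    (hω : 0 < ω) (hX : x₀ ≤ X)
    (hu : ∀ x ∈ Icc x₀ X, HasDerivAt u (u' x) x)
    (hu' : ∀ x ∈ Icc x₀ X, HasDerivAt u' (-(ω : ℂ) ^ 2 * u x + F x) x)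
    (hFm : AEStronglyMeasurable F (volume.restrict (Ioc x₀ X)))
    (hF : ∀ x ∈ Icc x₀ X, ‖F x‖ ≤ G x) (hG : IntervalIntegrable G volume x₀ X) :
    ‖u X‖ ≤ ‖u x₀‖ + ‖u' x₀‖ / ω + (∫ t in x₀..X, G t) / ω := by
  set a : ℝ → ℂ := fun t => ((Real.cos (ω * (t - X)) : ℝ) : ℂ) * (ω * u t) -
    ((Real.sin (ω * (t - X)) : ℝ) : ℂ) * u' t with ha
  have hderiv : ∀ t ∈ Icc x₀ X,
      HasDerivAt a (-(((Real.sin (ω * (t - X)) : ℝ) : ℂ) * F t)) t := by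
    intro t ht
    have h0 : HasDerivAt (fun t : ℝ => ω * (t - X)) ω t := by
      simpa using ((hasDerivAt_id t).sub_const X).const_mul ω
    have h1 := (h0.cos.ofReal_comp.mul ((hu t ht).const_mul (ω : ℂ))).sub
      (h0.sin.ofReal_comp.mul (hu' t ht))
    refine h1.congr_deriv ?_
    push_cast
    ring
  have hm : AEStronglyMeasurable (fun t : ℝ => -(((Real.sin (ω * (t - X)) : ℝ) : ℂ) * F t))
      (volume.restrict (Ioc x₀ X)) := by
    refine (AEStronglyMeasurable.mul ?_ hFm).neg
    exact (by fun_prop : Continuous fun t : ℝ =>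
      ((Real.sin (ω * (t - X)) : ℝ) : ℂ)).aestronglyMeasurable
  have h1 := norm_sub_le_integral_of_norm_deriv_le hX hderiv hm (g := G) (fun t ht => by
    rw [norm_neg, norm_mul, Complex.norm_real]
    refine (mul_le_of_le_one_left (norm_nonneg _) ?_).trans (hF t ht)
    exact Real.abs_sin_le_one _) hG
  have h2 : ‖a X‖ = ω * ‖u X‖ := by
    simp [ha, abs_of_pos hω]
  have h3 : ‖a x₀‖ ≤ ω * ‖u x₀‖ + ‖u' x₀‖ := by
    refine (norm_sub_le _ _).trans (add_le_add ?_ ?_)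
    · rw [norm_mul, norm_mul, Complex.norm_real, Complex.norm_real, Real.norm_of_nonneg hω.le]
      exact mul_le_of_le_one_left (by positivity) (Real.abs_cos_le_one _)
    · rw [norm_mul, Complex.norm_real]
      exact mul_le_of_le_one_left (by positivity) (Real.abs_sin_le_one _)
  have h4 := norm_le_insert (a x₀) (a X)
  rw [norm_sub_rev (a x₀) (a X)] at h4
  have h5 : ω * ‖u X‖ ≤ ω * ‖u x₀‖ + ‖u' x₀‖ + ∫ t in x₀..X, G t := by linarith
  refine le_of_mul_le_mul_left (h5.trans_eq ?_) hω
  field_simp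

theorem regular_region_bound {l X ω c' : ℝ} {u u' f q : ℝ → ℂ} {h : ℝ → ℝ} {c : ℂ}
    (hl : -(1 / 2 : ℝ) < l) (hX : 0 < X) (hω : 0 < ω) (hωX : ω * X ≤ 1)
    (hu : ∀ x ∈ Ioc 0 X, HasDerivAt u (u' x) x)
    (hu' : ∀ x ∈ Ioc 0 X, HasDerivAt u'
      (((l * (l + 1) / x ^ 2 : ℝ) : ℂ) * u x + ((q x - (ω : ℂ) ^ 2) * u x + f x)) x)
    (hqm : AEStronglyMeasurable q (volume.restrict (Ioc 0 X)))
    (hfm : AEStronglyMeasurable f (volume.restrict (Ioc 0 X)))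
    (hf : ∀ x ∈ Ioc 0 X, ‖f x‖ ≤ (ω * x) ^ (l + 1) * h x)
    (hq : IntervalIntegrable (fun t => t * ‖q t‖) volume 0 X)
    (hh : IntervalIntegrable (fun t => t * h t) volume 0 X)
    (hc : Tendsto (fun x : ℝ => u x / ((x ^ (l + 1) : ℝ) : ℂ)) (nhdsWithin 0 (Ioi 0)) (nhds c))
    (hc' : ‖c‖ = c' * ω ^ (l + 1)) :
    ‖u X‖ ≤ (ω * X) ^ (l + 1) * ((c' + 3 / (2 * l + 1) * ∫ t in (0 : ℝ)..X, t * h t) *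
      Real.exp (3 / (2 * l + 1) * ((∫ t in (0 : ℝ)..X, t * ‖q t‖) + 1 / 2))) ∧
    X * ‖u' X‖ ≤ (l + 1) * (ω * X) ^ (l + 1) *
      ((c' + 3 / (2 * l + 1) * ∫ t in (0 : ℝ)..X, t * h t) *
      Real.exp (3 / (2 * l + 1) * ((∫ t in (0 : ℝ)..X, t * ‖q t‖) + 1 / 2))) := by
  have hβ : 0 < 2 * l + 1 := by linarith
  set κ : ℝ := 3 / (2 * l + 1) with hκ
  have hκ0 : 0 < κ := by positivity
  set φ : ℝ → ℝ := fun t => ‖u t‖ / t ^ (l + 1) with hφ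
  have hωp := Real.rpow_pos_of_pos hω (l + 1)
  have hh0 : ∀ t ∈ Ioc 0 X, 0 ≤ h t := fun t ht =>
    nonneg_of_mul_nonneg_right ((norm_nonneg _).trans (hf t ht))
      (Real.rpow_pos_of_pos (mul_pos hω ht.1) _)
  have huc : ContinuousOn u (Ioc 0 X) := fun t ht => (hu t ht).continuousAt.continuousWithinAt
  have hφc : ContinuousOn φ (Ioc 0 X) := by
    refine huc.norm.div (fun t ht => ?_) fun t ht => (Real.rpow_pos_of_pos ht.1 _).ne'
    exact (Real.continuousAt_rpow_const _ _ (Or.inl ht.1.ne')).continuousWithinAt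
  have hφ0 : ∀ t ∈ Ioc 0 X, 0 ≤ φ t := fun t ht =>
    div_nonneg (norm_nonneg _) (Real.rpow_nonneg ht.1.le _)
  have hφt : Tendsto φ (nhdsWithin 0 (Ioi 0)) (nhds ‖c‖) := by
    refine hc.norm.congr' ?_
    filter_upwards [self_mem_nhdsWithin] with t ht
    rw [norm_div, Complex.norm_real, Real.norm_of_nonneg (Real.rpow_nonneg (le_of_lt ht) _)]
  obtain ⟨M, hM⟩ : ∃ M, ∀ t ∈ Ioc 0 X, φ t ≤ M := by
    obtain ⟨δ, hδ, hδ'⟩ := mem_nhdsGT_iff_exists_Ioo_subset.1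
      (hφt.eventually_lt_const (lt_add_one ‖c‖))
    have hδ : 0 < δ := hδ
    obtain ⟨M, hM⟩ := (isCompact_Icc (a := δ / 2) (b := X)).exists_bound_of_continuousOn
      (hφc.mono fun t ht => ⟨by linarith [ht.1], ht.2⟩)
    refine ⟨max M (‖c‖ + 1), fun t ht => ?_⟩
    by_cases htδ : t < δ
    · exact le_max_of_le_right (le_of_lt (hδ' ⟨ht.1, htδ⟩))
    · exact le_max_of_le_left ((le_abs_self _).trans (hM t ⟨by linarith, ht.2⟩))
  set k : ℝ → ℝ := fun t => κ * (t * ‖q t‖ + ω ^ 2 * t) with hk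
  have hki : IntervalIntegrable k volume 0 X :=
    (hq.add (intervalIntegral.intervalIntegrable_id.const_mul _)).const_mul _
  have hkφi : IntervalIntegrable (fun t => k t * φ t) volume 0 X := by
    rw [intervalIntegrable_iff_integrableOn_Ioc_of_le hX.le] at hki ⊢
    refine Integrable.mul_bdd (c := M) hki (hφc.aestronglyMeasurable measurableSet_Ioc) ?_
    filter_upwards [ae_restrict_mem measurableSet_Ioc] with t ht
    rw [Real.norm_of_nonneg (hφ0 t ht)]
    exact hM t ht
  have hsub : ∀ x ∈ Ioc 0 X, uIcc 0 x ⊆ uIcc 0 X := fun x hx => by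
    rw [uIcc_of_le hx.1.le, uIcc_of_le hX.le]; exact Icc_subset_Icc le_rfl hx.2
  have hmono : ∀ x ∈ Ioc 0 X, ∫ t in (0 : ℝ)..x, t * h t ≤ ∫ t in (0 : ℝ)..X, t * h t := by
    intro x hx
    refine intervalIntegral.integral_mono_interval le_rfl hx.1.le hx.2 ?_ hh
    filter_upwards [ae_restrict_mem measurableSet_Ioc] with t ht
    exact mul_nonneg ht.1.le (hh0 t ht)
  set a : ℝ := ω ^ (l + 1) * (c' + κ * ∫ t in (0 : ℝ)..X, t * h t) with ha
  have key : ∀ x ∈ Ioc 0 X, ‖u x‖ ≤ x ^ (l + 1) * (a + ∫ t in (0 : ℝ)..x, k t * φ t) ∧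
      x * ‖u' x‖ ≤ (l + 1) * x ^ (l + 1) * (a + ∫ t in (0 : ℝ)..x, k t * φ t) := by
    intro x hx
    have hIoc : Ioc 0 x ⊆ Ioc 0 X := Ioc_subset_Ioc le_rfl hx.2
    have hHe : (fun t => t * ((‖q t‖ + ω ^ 2) * φ t + ω ^ (l + 1) * h t)) =
        fun t => κ⁻¹ * (k t * φ t) + ω ^ (l + 1) * (t * h t) := by
      ext t; simp only [hk]; field_simp
    have i1 := (hkφi.mono_set (hsub x hx)).const_mul κ⁻¹
    have i2 := (hh.mono_set (hsub x hx)).const_mul (ω ^ (l + 1))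
    have hreg := regular_solution_bound (u := u) (u' := u') (c := c)
      (P := fun x => (q x - (ω : ℂ) ^ 2) * u x + f x)
      (H := fun t => (‖q t‖ + ω ^ 2) * φ t + ω ^ (l + 1) * h t) hl hx.1
      (fun t ht => hu t (hIoc ht)) (fun t ht => hu' t (hIoc ht)) ?_ ?_ ?_ hc
    · rw [hHe, intervalIntegral.integral_add i1 i2, intervalIntegral.integral_const_mul,
        intervalIntegral.integral_const_mul, ← hκ] at hreg
      have hle : ‖c‖ + κ * (κ⁻¹ * (∫ t in (0 : ℝ)..x, k t * φ t) +
          ω ^ (l + 1) * ∫ t in (0 : ℝ)..x, t * h t) ≤ a + ∫ t in (0 : ℝ)..x, k t * φ t := by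
        have h1 := mul_le_mul_of_nonneg_left (hmono x hx) (mul_pos hκ0 hωp).le
        rw [hc', ha, mul_add κ, ← mul_assoc κ κ⁻¹, mul_inv_cancel₀ hκ0.ne']
        linarith
      have hxp := Real.rpow_nonneg hx.1.le (l + 1)
      exact ⟨hreg.1.trans (mul_le_mul_of_nonneg_left hle hxp),
        hreg.2.trans (mul_le_mul_of_nonneg_left hle (mul_nonneg (by linarith) hxp))⟩
    · refine AEStronglyMeasurable.mono_measure ?_ (Measure.restrict_mono hIoc le_rfl)
      exact ((hqm.sub aestronglyMeasurable_const).mul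
        (huc.aestronglyMeasurable measurableSet_Ioc)).add hfm
    · intro t ht
      have htp := Real.rpow_pos_of_pos ht.1 (l + 1)
      refine (norm_add_le _ _).trans ?_
      have h1 : ‖q t - (ω : ℂ) ^ 2‖ ≤ ‖q t‖ + ω ^ 2 := by
        refine (norm_sub_le _ _).trans_eq ?_
        rw [norm_pow, Complex.norm_real, Real.norm_of_nonneg hω.le]
      have h2 := hf t (hIoc ht)
      rw [Real.mul_rpow hω.le ht.1.le] at h2
      have h3 : ‖u t‖ = t ^ (l + 1) * φ t := by simp only [hφ]; field_simp
      rw [norm_mul]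
      have h4 := mul_le_mul_of_nonneg_right h1 (norm_nonneg (u t))
      rw [h3] at h4 ⊢
      linarith
    · rw [hHe]; exact i1.add i2
  have hgr := gronwall_integral (φ := φ) (a := a) hX.le hki hkφi
    (fun t ht => mul_nonneg hκ0.le (add_nonneg (mul_nonneg ht.1.le (norm_nonneg _))
      (mul_nonneg (sq_nonneg _) ht.1.le)))
    (fun t ht => by
      simp only [hφ]
      rw [div_le_iff₀ (Real.rpow_pos_of_pos ht.1 _), mul_comm]
      exact (key t ht).1)
  have hkint : ∫ t in (0 : ℝ)..X, k t ≤ κ * ((∫ t in (0 : ℝ)..X, t * ‖q t‖) + 1 / 2) := by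
    simp only [hk]
    rw [intervalIntegral.integral_const_mul, intervalIntegral.integral_add hq
      (intervalIntegral.intervalIntegrable_id.const_mul _), intervalIntegral.integral_const_mul,
      integral_id]
    have : (ω * X) ^ 2 ≤ 1 := pow_le_one₀ (by positivity) hωX
    refine mul_le_mul_of_nonneg_left ?_ hκ0.le
    linarith
  have hc'0 : 0 ≤ c' := nonneg_of_mul_nonneg_left (hc' ▸ norm_nonneg c) hωp
  have hJ0 : 0 ≤ ∫ t in (0 : ℝ)..X, t * h t := by
    refine intervalIntegral.integral_nonneg_of_ae_restrict hX.le ?_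
    filter_upwards [ae_restrict_mem measurableSet_Icc,
      (Measure.ae_ne (volume.restrict (Icc 0 X)) 0)] with s hs hs'
    exact mul_nonneg hs.1 (hh0 s ⟨lt_of_le_of_ne hs.1 hs'.symm, hs.2⟩)
  have ha0 : 0 ≤ a := by positivity
  have hfin := hgr.trans (mul_le_mul_of_nonneg_left (Real.exp_le_exp.2 hkint) ha0)
  have hXp := Real.rpow_nonneg hX.le (l + 1)
  obtain ⟨k1, k2⟩ := key X ⟨hX, le_rfl⟩
  rw [Real.mul_rpow hω.le hX.le]
  constructor
  · refine k1.trans ((mul_le_mul_of_nonneg_left hfin hXp).trans_eq ?_)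
    rw [ha]; ring
  · refine k2.trans ((mul_le_mul_of_nonneg_left hfin
      (mul_nonneg (by linarith) hXp)).trans_eq ?_)
    rw [ha]; ring

theorem intervalIntegrable_of_id_mul {g : ℝ → ℝ} {x₀ X : ℝ} (h0 : 0 < x₀) (hX : x₀ ≤ X)
    (h : IntervalIntegrable (fun t => t * g t) volume x₀ X) : IntervalIntegrable g volume x₀ X := by
  have hc : ContinuousOn (fun t : ℝ => t⁻¹) (uIcc x₀ X) := by
    rw [uIcc_of_le hX]
    exact continuousOn_inv₀.mono fun t ht => (h0.trans_le ht.1).ne'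
  refine (h.continuousOn_mul hc).congr fun t ht => ?_
  rw [uIoc_of_le hX] at ht
  have : t ≠ 0 := (h0.trans ht.1).ne'
  field_simp

theorem oscillatory_region_bound {L X ω x₀ : ℝ} {u u' f q : ℝ → ℂ} {h : ℝ → ℝ}
    (hω : 0 < ω) (hx₀ : x₀ = 1 / ω) (hX : x₀ ≤ X)
    (hu : ∀ x ∈ Icc x₀ X, HasDerivAt u (u' x) x)
    (hu' : ∀ x ∈ Icc x₀ X, HasDerivAt u'
      (((L / x ^ 2 : ℝ) : ℂ) * u x + ((q x - (ω : ℂ) ^ 2) * u x + f x)) x)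
    (hqm : AEStronglyMeasurable q (volume.restrict (Ioc x₀ X)))
    (hfm : AEStronglyMeasurable f (volume.restrict (Ioc x₀ X)))
    (hf : ∀ x ∈ Icc x₀ X, ‖f x‖ ≤ h x)
    (hq : IntervalIntegrable (fun t => t * ‖q t‖) volume x₀ X)
    (hh : IntervalIntegrable h volume x₀ X) :
    ‖u X‖ ≤ (‖u x₀‖ + ‖u' x₀‖ / ω + (∫ t in x₀..X, h t) / ω) *
      Real.exp (|L| + ∫ t in x₀..X, t * ‖q t‖) := by
  have hx₀0 : 0 < x₀ := by rw [hx₀]; positivity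
  have huc : ContinuousOn u (Icc x₀ X) := fun t ht => (hu t ht).continuousAt.continuousWithinAt
  have hVc : ContinuousOn (fun t : ℝ => |L| / t ^ 2) (Icc x₀ X) :=
    continuousOn_const.div (by fun_prop) fun t ht => (pow_pos (hx₀0.trans_le ht.1) 2).ne'
  have hVi : IntervalIntegrable (fun t : ℝ => |L| / t ^ 2) volume x₀ X :=
    ContinuousOn.intervalIntegrable (by rwa [uIcc_of_le hX])
  have hqi : IntervalIntegrable (fun t => ‖q t‖) volume x₀ X :=
    intervalIntegrable_of_id_mul hx₀0 hX hq
  set k : ℝ → ℝ := fun t => ω⁻¹ * (|L| / t ^ 2 + ‖q t‖) with hk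
  have hki : IntervalIntegrable k volume x₀ X := (hVi.add hqi).const_mul _
  have hkφi : IntervalIntegrable (fun t => k t * ‖u t‖) volume x₀ X :=
    hki.mul_continuousOn (by rw [uIcc_of_le hX]; exact huc.norm)
  have hk0 : ∀ t, 0 ≤ k t := fun t => by positivity
  have hsub : ∀ x ∈ Icc x₀ X, uIcc x₀ x ⊆ uIcc x₀ X := fun x hx => by
    rw [uIcc_of_le hx.1, uIcc_of_le hX]; exact Icc_subset_Icc le_rfl hx.2
  have hh0 : ∀ t ∈ Icc x₀ X, 0 ≤ h t := fun t ht => (norm_nonneg _).trans (hf t ht)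
  set a : ℝ := ‖u x₀‖ + ‖u' x₀‖ / ω + (∫ t in x₀..X, h t) / ω with ha
  have key : ∀ x ∈ Icc x₀ X, ‖u x‖ ≤ a + ∫ t in x₀..x, k t * ‖u t‖ := by
    intro x hx
    have hsI : Icc x₀ x ⊆ Icc x₀ X := Icc_subset_Icc le_rfl hx.2
    have hGe : (fun t => (|L| / t ^ 2 + ‖q t‖) * ‖u t‖ + h t) =
        fun t => ω * (k t * ‖u t‖) + h t := by
      ext t; simp only [hk]; field_simp
    have i1 := (hkφi.mono_set (hsub x hx)).const_mul ω
    have i2 := hh.mono_set (hsub x hx)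
    have hos := oscillatory_solution_bound (u := u) (u' := u')
      (F := fun t => ((L / t ^ 2 : ℝ) : ℂ) * u t + q t * u t + f t)
      (G := fun t => (|L| / t ^ 2 + ‖q t‖) * ‖u t‖ + h t) hω hx.1
      (fun t ht => hu t (hsI ht))
      (fun t ht => (hu' t (hsI ht)).congr_deriv (by ring)) ?_ ?_ ?_
    · rw [hGe, intervalIntegral.integral_add i1 i2, intervalIntegral.integral_const_mul,
        add_div, mul_div_cancel_left₀ _ hω.ne'] at hos
      have hm : ∫ t in x₀..x, h t ≤ ∫ t in x₀..X, h t := by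
        refine intervalIntegral.integral_mono_interval le_rfl hx.1 hx.2 ?_ hh
        filter_upwards [ae_restrict_mem measurableSet_Ioc] with t ht
        exact hh0 t (Ioc_subset_Icc_self ht)
      have hm' := div_le_div_of_nonneg_right hm hω.le
      rw [ha]; linarith
    · refine AEStronglyMeasurable.mono_measure ?_
        (Measure.restrict_mono (Ioc_subset_Ioc le_rfl hx.2) le_rfl)
      have hum := (huc.mono Ioc_subset_Icc_self).aestronglyMeasurable (μ := volume)
        measurableSet_Ioc
      refine ((AEStronglyMeasurable.mul ?_ hum).add (hqm.mul hum)).add hfm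
      exact (by fun_prop : Measurable fun t : ℝ => ((L / t ^ 2 : ℝ) : ℂ)).aestronglyMeasurable
    · intro t ht
      refine (norm_add_le _ _).trans (add_le_add ?_ (hf t (hsI ht)))
      refine (norm_add_le _ _).trans_eq ?_
      rw [norm_mul, norm_mul, Complex.norm_real, Real.norm_eq_abs, abs_div,
        abs_of_nonneg (sq_nonneg t), add_mul]
    · rw [hGe]; exact i1.add i2
  have hgr := gronwall_integral (φ := fun t => ‖u t‖) (a := a) hX hki hkφi
    (fun t _ => hk0 t) (fun t ht => key t (Ioc_subset_Icc_self ht))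
  have hVint : ∫ t in x₀..X, |L| / t ^ 2 ≤ |L| * ω := by
    have hd : ∀ t ∈ uIcc x₀ X, HasDerivAt (fun t : ℝ => -(|L| * t⁻¹)) (|L| / t ^ 2) t := by
      intro t ht
      rw [uIcc_of_le hX] at ht
      refine ((hasDerivAt_inv (hx₀0.trans_le ht.1).ne').const_mul |L|).neg.congr_deriv ?_
      ring
    rw [intervalIntegral.integral_eq_sub_of_hasDerivAt hd hVi, hx₀]
    have : 0 ≤ |L| * X⁻¹ := mul_nonneg (abs_nonneg _) (inv_nonneg.2 (hx₀0.le.trans hX))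
    simp only [one_div, inv_inv]
    linarith
  have hqint : ω⁻¹ * ∫ t in x₀..X, ‖q t‖ ≤ ∫ t in x₀..X, t * ‖q t‖ := by
    rw [← intervalIntegral.integral_const_mul]
    refine intervalIntegral.integral_mono_on hX (hqi.const_mul _) hq fun t ht => ?_
    refine mul_le_mul_of_nonneg_right ?_ (norm_nonneg _)
    rw [← one_div, ← hx₀]; exact ht.1
  have hkint : ∫ t in x₀..X, k t ≤ |L| + ∫ t in x₀..X, t * ‖q t‖ := by
    simp only [hk]
    rw [intervalIntegral.integral_const_mul, intervalIntegral.integral_add hVi hqi, mul_add]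
    refine add_le_add ?_ hqint
    rw [inv_mul_le_iff₀ hω, mul_comm ω]
    exact hVint
  have hJ0 : 0 ≤ ∫ t in x₀..X, h t := intervalIntegral.integral_nonneg hX hh0
  have ha0 : 0 ≤ a := by positivity
  exact (key X ⟨hX, le_rfl⟩).trans (hgr.trans
    (mul_le_mul_of_nonneg_left (Real.exp_le_exp.2 hkint) ha0))

theorem exists_solution_bound {l : ℝ} (hl : -(1 / 2 : ℝ) < l) :
    ∃ K : ℝ, 0 < K ∧ ∀ (X ω c' : ℝ) (u u' f q : ℝ → ℂ) (h : ℝ → ℝ) (c : ℂ), 0 < X → 0 < ω →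
    (∀ x ∈ Ioc 0 X, HasDerivAt u (u' x) x) →
    (∀ x ∈ Ioc 0 X, HasDerivAt u'
      (((l * (l + 1) / x ^ 2 : ℝ) : ℂ) * u x + ((q x - (ω : ℂ) ^ 2) * u x + f x)) x) →
    AEStronglyMeasurable q (volume.restrict (Ioc 0 X)) →
    AEStronglyMeasurable f (volume.restrict (Ioc 0 X)) →
    (∀ x ∈ Ioc 0 X, ‖f x‖ ≤ (min 1 (ω * x)) ^ (l + 1) * h x) →
    IntervalIntegrable (fun t => t * ‖q t‖) volume 0 X →
    IntervalIntegrable (fun t => t * h t) volume 0 X →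
    Tendsto (fun x : ℝ => u x / ((x ^ (l + 1) : ℝ) : ℂ)) (nhdsWithin 0 (Ioi 0)) (nhds c) →
    ‖c‖ = c' * ω ^ (l + 1) →
    ‖u X‖ ≤ K * (min 1 (ω * X)) ^ (l + 1) * (c' + ∫ t in (0 : ℝ)..X, min t (1 / ω) * h t) *
      Real.exp (K * ∫ t in (0 : ℝ)..X, t * ‖q t‖) := by
  have hβ : 0 < 2 * l + 1 := by linarith
  set κ : ℝ := 3 / (2 * l + 1) with hκ
  have hκ0 : 0 < κ := by positivity
  set K₁ : ℝ := (l + 2) * (1 + κ) * Real.exp (κ / 2 + |l * (l + 1)|) with hK₁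
  have hl2 : 0 < l + 2 := by linarith
  have hK₁0 : 0 < K₁ := by positivity
  refine ⟨K₁ + κ + 1, by positivity, ?_⟩
  set K : ℝ := K₁ + κ + 1 with hK
  intro X ω c' u u' f q h c hX hω hu hu' hqm hfm hf hq hh hc hc'
  have hωp := Real.rpow_pos_of_pos hω (l + 1)
  have hc'0 : 0 ≤ c' := nonneg_of_mul_nonneg_left (hc' ▸ norm_nonneg c) hωp
  have hh0 : ∀ t ∈ Ioc 0 X, 0 ≤ h t := fun t ht =>
    nonneg_of_mul_nonneg_right ((norm_nonneg _).trans (hf t ht))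
      (Real.rpow_pos_of_pos (lt_min one_pos (mul_pos hω ht.1)) _)
  have hreg : ∀ Y ∈ Ioc 0 X, ω * Y ≤ 1 → _ := fun Y hY hωY =>
    regular_region_bound (X := Y) (ω := ω) (c' := c') (u := u) (u' := u') (f := f) (q := q)
      (h := h) (c := c) hl hY.1 hω hωY
      (fun x hx => hu x (Ioc_subset_Ioc le_rfl hY.2 hx))
      (fun x hx => hu' x (Ioc_subset_Ioc le_rfl hY.2 hx))
      (hqm.mono_measure (Measure.restrict_mono (Ioc_subset_Ioc le_rfl hY.2) le_rfl))
      (hfm.mono_measure (Measure.restrict_mono (Ioc_subset_Ioc le_rfl hY.2) le_rfl))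
      (fun x hx => by
        have h1 := hf x (Ioc_subset_Ioc le_rfl hY.2 hx)
        rwa [min_eq_right ((mul_le_mul_of_nonneg_left hx.2 hω.le).trans hωY)] at h1)
      (hq.mono_set (by
        rw [uIcc_of_le hY.1.le, uIcc_of_le hX.le]; exact Icc_subset_Icc le_rfl hY.2))
      (hh.mono_set (by
        rw [uIcc_of_le hY.1.le, uIcc_of_le hX.le]; exact Icc_subset_Icc le_rfl hY.2))
      hc hc'
  have hnonneg : ∀ Y ∈ Ioc 0 X, 0 ≤ ∫ t in (0 : ℝ)..Y, t * h t := fun Y hY => by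
    refine intervalIntegral.integral_nonneg_of_ae_restrict hY.1.le ?_
    filter_upwards [ae_restrict_mem measurableSet_Icc,
      (Measure.ae_ne (volume.restrict (Icc 0 Y)) 0)] with s hs hs'
    exact mul_nonneg hs.1 (hh0 s ⟨lt_of_le_of_ne hs.1 hs'.symm, hs.2.trans hY.2⟩)
  have hmin : ∀ Y, 0 < Y → ω * Y ≤ 1 →
      ∫ t in (0 : ℝ)..Y, min t (1 / ω) * h t = ∫ t in (0 : ℝ)..Y, t * h t := by
    intro Y hY hωY
    refine intervalIntegral.integral_congr fun t ht => ?_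
    rw [uIcc_of_le hY.le] at ht
    have h1 : t ≤ 1 / ω := by
      rw [le_div_iff₀ hω, mul_comm]
      exact (mul_le_mul_of_nonneg_left ht.2 hω.le).trans hωY
    simp only [min_eq_left h1]
  have hQ : ∀ Y, 0 ≤ Y → 0 ≤ ∫ t in (0 : ℝ)..Y, t * ‖q t‖ := fun Y hY =>
    intervalIntegral.integral_nonneg hY fun t ht => mul_nonneg ht.1 (norm_nonneg _)
  rcases le_or_gt (ω * X) 1 with hωX | hωX
  · have h1 := (hreg X ⟨hX, le_rfl⟩ hωX).1
    rw [min_eq_right hωX, hmin X hX hωX]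
    rw [← hκ] at h1
    set J := ∫ t in (0 : ℝ)..X, t * h t
    set Q := ∫ t in (0 : ℝ)..X, t * ‖q t‖
    have hJ : 0 ≤ J := hnonneg X ⟨hX, le_rfl⟩
    have hQ0 : 0 ≤ Q := hQ X hX.le
    have hp := Real.rpow_nonneg (mul_pos hω hX).le (l + 1)
    have e1 : c' + κ * J ≤ (1 + κ) * (c' + J) := by nlinarith
    have e2 : Real.exp (κ * (Q + 1 / 2)) ≤ Real.exp (κ / 2 + |l * (l + 1)|) * Real.exp (K * Q) := by
      rw [← Real.exp_add, Real.exp_le_exp]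
      have : κ * Q ≤ K * Q := mul_le_mul_of_nonneg_right (by linarith) hQ0
      have := abs_nonneg (l * (l + 1))
      linarith
    have e3 : (1 + κ) * Real.exp (κ / 2 + |l * (l + 1)|) ≤ K := by
      have : 0 ≤ (l + 1) * ((1 + κ) * Real.exp (κ / 2 + |l * (l + 1)|)) :=
        mul_nonneg (by linarith) (by positivity)
      linarith
    calc ‖u X‖ ≤ _ := h1
      _ ≤ (ω * X) ^ (l + 1) * (((1 + κ) * (c' + J)) *
          (Real.exp (κ / 2 + |l * (l + 1)|) * Real.exp (K * Q))) := by gcongr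
      _ = (ω * X) ^ (l + 1) * (((1 + κ) * Real.exp (κ / 2 + |l * (l + 1)|)) *
          ((c' + J) * Real.exp (K * Q))) := by ring
      _ ≤ (ω * X) ^ (l + 1) * (K * ((c' + J) * Real.exp (K * Q))) := by gcongr
      _ = _ := by ring
  · set x₀ : ℝ := 1 / ω with hx₀
    have hx₀0 : 0 < x₀ := by positivity
    have hωx₀ : ω * x₀ = 1 := by rw [hx₀]; field_simp
    have hx₀X : x₀ < X := by
      rw [hx₀, div_lt_iff₀ hω, mul_comm]; exact hωX
    have hIcc : Icc x₀ X ⊆ Ioc 0 X := fun t ht => ⟨hx₀0.trans_le ht.1, ht.2⟩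
    have hIoc : Ioc x₀ X ⊆ Ioc 0 X := Ioc_subset_Ioc hx₀0.le le_rfl
    have hs1 : uIcc x₀ X ⊆ uIcc 0 X := by
      rw [uIcc_of_le hx₀X.le, uIcc_of_le hX.le]; exact Icc_subset_Icc hx₀0.le le_rfl
    have hs0 : uIcc 0 x₀ ⊆ uIcc 0 X := by
      rw [uIcc_of_le hx₀0.le, uIcc_of_le hX.le]; exact Icc_subset_Icc le_rfl hx₀X.le
    obtain ⟨r1, r2⟩ := hreg x₀ ⟨hx₀0, hx₀X.le⟩ hωx₀.le
    have hhi : IntervalIntegrable h volume x₀ X :=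
      intervalIntegrable_of_id_mul hx₀0 hx₀X.le (hh.mono_set hs1)
    have hosc := oscillatory_region_bound (L := l * (l + 1)) (u := u) (u' := u') (f := f) (q := q)
      (h := h) hω hx₀ hx₀X.le (fun x hx => hu x (hIcc hx)) (fun x hx => hu' x (hIcc hx))
      (hqm.mono_measure (Measure.restrict_mono hIoc le_rfl))
      (hfm.mono_measure (Measure.restrict_mono hIoc le_rfl))
      (fun x hx => by
        have h1 := hf x (hIcc hx)
        rwa [min_eq_left, Real.one_rpow, one_mul] at h1
        rw [← hωx₀]; exact mul_le_mul_of_nonneg_left hx.1 hω.le)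
      (hq.mono_set hs1) hhi
    rw [min_eq_left hωX.le, Real.one_rpow, mul_one]
    have hJsplit : ∫ t in (0 : ℝ)..X, min t x₀ * h t =
        (∫ t in (0 : ℝ)..x₀, t * h t) + (∫ t in x₀..X, h t) / ω := by
      have hcong : EqOn (fun t => x₀ * h t) (fun t => min t x₀ * h t) (uIcc x₀ X) := by
        intro t ht
        rw [uIcc_of_le hx₀X.le] at ht
        simp only [min_eq_right ht.1]
      have hcong0 : EqOn (fun t => t * h t) (fun t => min t x₀ * h t) (uIcc 0 x₀) := by
        intro t ht
        rw [uIcc_of_le hx₀0.le] at ht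
        simp only [min_eq_left ht.2]
      rw [← intervalIntegral.integral_add_adjacent_intervals (b := x₀)
        ((hh.mono_set hs0).congr (hcong0.mono uIoc_subset_uIcc))
        ((hhi.const_mul x₀).congr (hcong.mono uIoc_subset_uIcc)),
        ← intervalIntegral.integral_congr hcong, ← intervalIntegral.integral_congr hcong0,
        intervalIntegral.integral_const_mul, hx₀]
      ring
    have hQsplit := intervalIntegral.integral_add_adjacent_intervals (hq.mono_set hs0)
      (hq.mono_set hs1)
    rw [hJsplit, ← hQsplit]
    rw [hωx₀, Real.one_rpow, ← hκ] at r1 r2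
    have hJ0 : 0 ≤ ∫ t in (0 : ℝ)..x₀, t * h t := hnonneg x₀ ⟨hx₀0, hx₀X.le⟩
    have hJ1 : 0 ≤ (∫ t in x₀..X, h t) / ω := div_nonneg
      (intervalIntegral.integral_nonneg hx₀X.le fun t ht => hh0 t (hIcc ht)) hω.le
    have hQ0 : 0 ≤ ∫ t in (0 : ℝ)..x₀, t * ‖q t‖ := hQ x₀ hx₀0.le
    have hQ1 : 0 ≤ ∫ t in x₀..X, t * ‖q t‖ := intervalIntegral.integral_nonneg hx₀X.le
      fun t ht => mul_nonneg (hx₀0.le.trans ht.1) (norm_nonneg _)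
    have r2' : ‖u' x₀‖ / ω = x₀ * ‖u' x₀‖ := by rw [hx₀]; ring
    rw [r2'] at hosc
    set J0 := ∫ t in (0 : ℝ)..x₀, t * h t
    set J1 := (∫ t in x₀..X, h t) / ω
    set Q0 := ∫ t in (0 : ℝ)..x₀, t * ‖q t‖
    set Q1 := ∫ t in x₀..X, t * ‖q t‖
    set E0 := Real.exp (κ * (Q0 + 1 / 2)) with hE0
    have hE1 : 1 ≤ E0 := Real.one_le_exp (by positivity)
    have e1 : ‖u x₀‖ + x₀ * ‖u' x₀‖ + J1 ≤ (l + 2) * (1 + κ) * (c' + (J0 + J1)) * E0 := by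
      have t1 : ‖u x₀‖ + x₀ * ‖u' x₀‖ ≤ (l + 2) * ((c' + κ * J0) * E0) := by linarith
      have t2 : (l + 2) * ((c' + κ * J0) * E0) ≤ (l + 2) * (((1 + κ) * (c' + J0)) * E0) := by
        gcongr
        nlinarith
      have t3 : J1 ≤ (l + 2) * (1 + κ) * J1 * E0 := by
        have s1 : 1 ≤ (l + 2) * (1 + κ) := one_le_mul_of_one_le_of_one_le (by linarith)
          (by linarith)
        have s2 : 1 ≤ (l + 2) * (1 + κ) * E0 := one_le_mul_of_one_le_of_one_le s1 hE1
        have := mul_le_mul_of_nonneg_right s2 hJ1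
        linarith
      linarith
    have e2 : E0 * Real.exp (|l * (l + 1)| + Q1) ≤
        Real.exp (κ / 2 + |l * (l + 1)|) * Real.exp (K * (Q0 + Q1)) := by
      rw [hE0, ← Real.exp_add, ← Real.exp_add, Real.exp_le_exp]
      have s1 : κ * Q0 ≤ K * Q0 := mul_le_mul_of_nonneg_right (by linarith) hQ0
      have s2 : 1 * Q1 ≤ K * Q1 := mul_le_mul_of_nonneg_right (by linarith) hQ1
      linarith
    have hS : 0 ≤ c' + (J0 + J1) := by positivity
    calc ‖u X‖ ≤ _ := hosc
      _ ≤ (l + 2) * (1 + κ) * (c' + (J0 + J1)) * E0 * Real.exp (|l * (l + 1)| + Q1) := by gcongr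
      _ = (l + 2) * (1 + κ) * (c' + (J0 + J1)) * (E0 * Real.exp (|l * (l + 1)| + Q1)) := by ring
      _ ≤ (l + 2) * (1 + κ) * (c' + (J0 + J1)) *
          (Real.exp (κ / 2 + |l * (l + 1)|) * Real.exp (K * (Q0 + Q1))) := by gcongr
      _ = K₁ * ((c' + (J0 + J1)) * Real.exp (K * (Q0 + Q1))) := by rw [hK₁]; ring
      _ ≤ K * ((c' + (J0 + J1)) * Real.exp (K * (Q0 + Q1))) := by gcongr; linarith
      _ = _ := by ring

theorem min_inv_le_rpow_mul {b t ω μ : ℝ} (ht : 0 < t) (htb : t ≤ b) (hω : 0 < ω)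
    (hμ0 : 0 ≤ μ) (hμ1 : μ ≤ 1) :
    min t (1 / ω) ≤ t ^ μ * ((1 + b) / (1 + ω)) ^ (1 - μ) := by
  have hm : 0 < min t (1 / ω) := lt_min ht (by positivity)
  have h1 : min t (1 / ω) ≤ (1 + b) / (1 + ω) := by
    rw [le_div_iff₀ (by positivity)]
    have h2 : min t (1 / ω) * ω ≤ 1 := by
      have := mul_le_mul_of_nonneg_right (min_le_right t (1 / ω)) hω.le
      rwa [one_div_mul_cancel hω.ne'] at this
    have h3 := min_le_left t (1 / ω)
    linarith
  calc min t (1 / ω) = min t (1 / ω) ^ μ * min t (1 / ω) ^ (1 - μ) := by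
        rw [← Real.rpow_add hm]; simp
    _ ≤ _ := by
        gcongr
        exact min_le_left _ _

theorem intervalIntegrable_id_mul_of_rpow {b μ : ℝ} {q : ℝ → ℂ} (hμ1 : μ ≤ 1)
    (hq : Measurable q)
    (h : IntegrableOn (fun t : ℝ => t ^ μ * ‖q t‖) (Ioo 0 b)) {x : ℝ} (hx : x ∈ Ioc 0 b) :
    IntervalIntegrable (fun t => t * ‖q t‖) volume 0 x := by
  rw [intervalIntegrable_iff_integrableOn_Ioo_of_le hx.1.le]
  have h' := (h.mono_set (Ioo_subset_Ioo le_rfl hx.2)).const_mul (b ^ (1 - μ))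
  refine Integrable.mono' h' (by fun_prop) ?_
  filter_upwards [ae_restrict_mem measurableSet_Ioo] with t ht
  rw [Real.norm_of_nonneg (mul_nonneg ht.1.le (norm_nonneg _)), ← mul_assoc]
  refine mul_le_mul_of_nonneg_right ?_ (norm_nonneg _)
  calc t = t ^ (1 - μ) * t ^ μ := by rw [← Real.rpow_add ht.1]; simp
    _ ≤ _ := by
      have := ht.1
      have := ht.2
      have := hx.2
      gcongr; linarith

theorem exists_difference_bound {b l μ : ℝ} (hl : -(1 / 2 : ℝ) < l) (hμ0 : 0 ≤ μ) (hμ : μ < 1 / 2)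
    {c₀ : ℝ} (hc₀ : 0 < c₀) :
    ∃ K : ℝ, 0 < K ∧ ∀ (q₁ q₂ : ℝ → ℂ) (y₁ y₂ y₁' y₂' : ℝ → ℂ) (ω x : ℝ) (c : ℂ),
      Measurable q₁ → Measurable q₂ →
      IntegrableOn (fun t : ℝ => t ^ μ * ‖q₁ t‖) (Ioo 0 b) →
      IntegrableOn (fun t : ℝ => t ^ μ * ‖q₂ t‖) (Ioo 0 b) →
      (∀ x ∈ Ioc 0 b, HasDerivAt y₁ (y₁' x) x) →
      (∀ x ∈ Ioc 0 b, HasDerivAt y₁'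
        (((l * (l + 1) / x ^ 2 : ℝ) : ℂ) * y₁ x + (q₁ x - (ω : ℂ) ^ 2) * y₁ x) x) →
      (∀ x ∈ Ioc 0 b, HasDerivAt y₂ (y₂' x) x) →
      (∀ x ∈ Ioc 0 b, HasDerivAt y₂'
        (((l * (l + 1) / x ^ 2 : ℝ) : ℂ) * y₂ x + (q₂ x - (ω : ℂ) ^ 2) * y₂ x) x) →
      Tendsto (fun x : ℝ => y₁ x / ((x ^ (l + 1) : ℝ) : ℂ)) (nhdsWithin 0 (Ioi 0)) (nhds c) →
      Tendsto (fun x : ℝ => y₂ x / ((x ^ (l + 1) : ℝ) : ℂ)) (nhdsWithin 0 (Ioi 0)) (nhds c) →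
      0 < ω → ‖c‖ = c₀ * ω ^ (l + 1) → x ∈ Ioc 0 b →
      ‖y₁ x - y₂ x‖ ≤ (K ^ 2 * c₀ * Real.exp (K * ∫ t in Ioo 0 x, t * ‖q₁ t‖) *
        Real.exp (K * ∫ t in Ioo 0 x, t * ‖q₂ t‖) * ∫ t in Ioo 0 x, t ^ μ * ‖q₁ t - q₂ t‖) *
        ((1 + b) / (1 + ω)) ^ (1 - μ) := by
  obtain ⟨K, hK, hmain⟩ := exists_solution_bound hl
  refine ⟨K, hK, ?_⟩
  intro q₁ q₂ y₁ y₂ y₁' y₂' ω x c hm₁ hm₂ hq₁ hq₂ hy₁ hy₁' hy₂ hy₂' ht₁ ht₂ hω hc hx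
  have hsub : Ioc 0 x ⊆ Ioc 0 b := Ioc_subset_Ioc le_rfl hx.2
  have hμ1 : μ ≤ 1 := by linarith
  have hi₁ := intervalIntegrable_id_mul_of_rpow hμ1 hm₁ hq₁ hx
  have hi₂ := intervalIntegrable_id_mul_of_rpow hμ1 hm₂ hq₂ hx
  have hconv : ∀ g : ℝ → ℝ, ∫ t in Ioo 0 x, g t = ∫ t in (0 : ℝ)..x, g t := fun g => by
    rw [intervalIntegral.integral_of_le hx.1.le, integral_Ioc_eq_integral_Ioo]
  set B : ℝ := K * c₀ * Real.exp (K * ∫ t in Ioo 0 x, t * ‖q₂ t‖) with hB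
  have hB0 : 0 ≤ B := by positivity
  have hy₂bd : ∀ s ∈ Ioc 0 x, ‖y₂ s‖ ≤ (min 1 (ω * s)) ^ (l + 1) * B := by
    intro s hs
    have hsb : Ioc 0 s ⊆ Ioc 0 b := Ioc_subset_Ioc le_rfl (hsub hs).2
    have h1 := hmain s ω c₀ y₂ y₂' (fun _ => 0) q₂ (fun _ => 0) c hs.1 hω
      (fun t ht => hy₂ t (hsb ht)) (fun t ht => by simpa using hy₂' t (hsb ht))
      hm₂.aestronglyMeasurable aestronglyMeasurable_const (by simp)
      (intervalIntegrable_id_mul_of_rpow hμ1 hm₂ hq₂ (hsub hs)) (by simp) ht₂ hc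
    have h2 : ∫ t in (0 : ℝ)..s, t * ‖q₂ t‖ ≤ ∫ t in (0 : ℝ)..x, t * ‖q₂ t‖ := by
      refine intervalIntegral.integral_mono_interval le_rfl hs.1.le hs.2 ?_ hi₂
      filter_upwards [ae_restrict_mem measurableSet_Ioc] with t ht
      exact mul_nonneg ht.1.le (norm_nonneg _)
    have hp : 0 ≤ (min 1 (ω * s)) ^ (l + 1) :=
      Real.rpow_nonneg (le_min zero_le_one (mul_pos hω hs.1).le) _
    simp only [mul_zero, intervalIntegral.integral_zero, add_zero] at h1
    refine h1.trans ?_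
    rw [hB, hconv]
    calc _ ≤ K * min 1 (ω * s) ^ (l + 1) * c₀ *
          Real.exp (K * ∫ t in (0 : ℝ)..x, t * ‖q₂ t‖) := by gcongr
      _ = _ := by ring
  have hJi : IntegrableOn (fun t : ℝ => t ^ μ * ‖q₁ t - q₂ t‖) (Ioo 0 x) := by
    have h1 := (hq₁.add hq₂).mono_set (Ioo_subset_Ioo (le_refl (0 : ℝ)) hx.2)
    refine Integrable.mono' h1 (by fun_prop) ?_
    filter_upwards [ae_restrict_mem measurableSet_Ioo] with t ht
    have hp := Real.rpow_nonneg ht.1.le μ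
    rw [Real.norm_of_nonneg (mul_nonneg hp (norm_nonneg _))]
    simp only [Pi.add_apply]
    rw [← mul_add]
    exact mul_le_mul_of_nonneg_left (norm_sub_le _ _) hp
  have hdi : IntervalIntegrable (fun t => t * ‖q₁ t - q₂ t‖) volume 0 x :=
    intervalIntegrable_id_mul_of_rpow (q := fun t => q₁ t - q₂ t) hμ1 (hm₁.sub hm₂) hJi
      ⟨hx.1, le_rfl⟩
  have hy₂c : ContinuousOn y₂ (Ioc 0 x) := fun t ht =>
    (hy₂ t (hsub ht)).continuousAt.continuousWithinAt
  have h1 := hmain x ω 0 (fun t => y₁ t - y₂ t) (fun t => y₁' t - y₂' t)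
    (fun t => (q₁ t - q₂ t) * y₂ t) q₁ (fun t => B * ‖q₁ t - q₂ t‖) 0 hx.1 hω
    (fun t ht => (hy₁ t (hsub ht)).sub (hy₂ t (hsub ht)))
    (fun t ht => ((hy₁' t (hsub ht)).sub (hy₂' t (hsub ht))).congr_deriv (by ring))
    hm₁.aestronglyMeasurable
    ((hm₁.sub hm₂).aestronglyMeasurable.mul (hy₂c.aestronglyMeasurable measurableSet_Ioc))
    (fun t ht => by
      rw [norm_mul]
      have := mul_le_mul_of_nonneg_left (hy₂bd t ht) (norm_nonneg (q₁ t - q₂ t))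
      linarith) hi₁
    ((hdi.const_mul B).congr fun t _ => by ring)
    (by simpa [sub_div] using ht₁.sub ht₂) (by simp)
  have hg0 : 0 ≤ ((1 + b) / (1 + ω)) ^ (1 - μ) :=
    Real.rpow_nonneg (div_nonneg (by linarith [hx.1, hx.2]) (by linarith)) _
  have h2 : ∫ t in (0 : ℝ)..x, min t (1 / ω) * (B * ‖q₁ t - q₂ t‖) ≤
      B * ((1 + b) / (1 + ω)) ^ (1 - μ) * ∫ t in Ioo 0 x, t ^ μ * ‖q₁ t - q₂ t‖ := by
    rw [← hconv, ← integral_const_mul]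
    refine integral_mono_of_nonneg ?_ (hJi.const_mul _) ?_
    · filter_upwards [ae_restrict_mem measurableSet_Ioo] with t ht
      have := le_min ht.1.le (one_div_pos.2 hω).le
      simp only [Pi.zero_apply]
      positivity
    · filter_upwards [ae_restrict_mem measurableSet_Ioo] with t ht
      have h3 := mul_le_mul_of_nonneg_right
        (min_inv_le_rpow_mul ht.1 (ht.2.le.trans hx.2) hω hμ0 hμ1)
        (mul_nonneg hB0 (norm_nonneg (q₁ t - q₂ t)))
      linarith
  have hm1 : min 1 (ω * x) ^ (l + 1) ≤ 1 :=
    Real.rpow_le_one (le_min zero_le_one (mul_pos hω hx.1).le) (min_le_left _ _) (by linarith)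
  have hJ0 : 0 ≤ ∫ t in Ioo 0 x, t ^ μ * ‖q₁ t - q₂ t‖ := by
    refine setIntegral_nonneg measurableSet_Ioo fun t ht => ?_
    exact mul_nonneg (Real.rpow_nonneg ht.1.le _) (norm_nonneg _)
  have hm0 : 0 ≤ min 1 (ω * x) ^ (l + 1) :=
    Real.rpow_nonneg (le_min zero_le_one (mul_pos hω hx.1).le) _
  rw [zero_add] at h1
  rw [← hconv (fun t => t * ‖q₁ t‖)] at h1
  calc ‖y₁ x - y₂ x‖ ≤ _ := h1
    _ ≤ K * min 1 (ω * x) ^ (l + 1) *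
        (B * ((1 + b) / (1 + ω)) ^ (1 - μ) * ∫ t in Ioo 0 x, t ^ μ * ‖q₁ t - q₂ t‖) *
        Real.exp (K * ∫ t in Ioo 0 x, t * ‖q₁ t‖) := by gcongr
    _ ≤ K * 1 *
        (B * ((1 + b) / (1 + ω)) ^ (1 - μ) * ∫ t in Ioo 0 x, t ^ μ * ‖q₁ t - q₂ t‖) *
        Real.exp (K * ∫ t in Ioo 0 x, t * ‖q₁ t‖) := by gcongr
    _ = _ := by rw [hB]; ring

theorem lintegral_sq_rpow_half_le {g : ℝ → ℂ} {D b μ : ℝ} (hb : 0 < b) (hD : 0 ≤ D)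
    (hμ : μ < 1 / 2)
    (hg : ∀ ω : ℝ, ω ≠ 0 → ‖g ω‖ ≤ D * ((1 + b) / (1 + |ω|)) ^ (1 - μ)) :
    (∫⁻ ω : ℝ, (‖g ω‖₊ : ENNReal) ^ 2) ^ (1 / 2 : ℝ) ≤
      ENNReal.ofReal (D * (1 + b) ^ (1 - μ) *
        Real.sqrt (∫ ω : ℝ, (1 + ‖ω‖) ^ (-(2 * (1 - μ))))) := by
  have hint : Integrable (fun ω : ℝ => (1 + ‖ω‖) ^ (-(2 * (1 - μ)))) :=
    integrable_one_add_norm (by simp; linarith)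
  have hA : 0 ≤ D * (1 + b) ^ (1 - μ) := by positivity
  have hW : 0 ≤ ∫ ω : ℝ, (1 + ‖ω‖) ^ (-(2 * (1 - μ))) :=
    integral_nonneg fun ω => by positivity
  have hle : ∫⁻ ω : ℝ, (‖g ω‖₊ : ENNReal) ^ 2 ≤
      ENNReal.ofReal ((D * (1 + b) ^ (1 - μ)) ^ 2 * ∫ ω : ℝ, (1 + ‖ω‖) ^ (-(2 * (1 - μ)))) := by
    rw [← integral_const_mul, ofReal_integral_eq_lintegral_ofReal (hint.const_mul _)
      (Eventually.of_forall fun ω => by positivity)]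
    refine lintegral_mono_ae ?_
    filter_upwards [Measure.ae_ne volume (0 : ℝ)] with ω hω
    have h1 : (‖g ω‖₊ : ENNReal) = ENNReal.ofReal ‖g ω‖ := (ofReal_norm (g ω)).symm
    rw [h1, ← ENNReal.ofReal_pow (norm_nonneg _)]
    refine ENNReal.ofReal_le_ofReal ((pow_le_pow_left₀ (norm_nonneg _) (hg ω hω) 2).trans_eq ?_)
    have hp : 0 < 1 + |ω| := by positivity
    rw [Real.norm_eq_abs, Real.div_rpow (by positivity) hp.le, Real.rpow_neg hp.le,
      two_mul, Real.rpow_add hp]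
    field_simp
  refine (ENNReal.rpow_le_rpow hle (by norm_num)).trans_eq ?_
  rw [ENNReal.ofReal_rpow_of_nonneg (by positivity) (by norm_num), ← Real.sqrt_eq_rpow,
    Real.sqrt_mul (sq_nonneg _), Real.sqrt_sq hA]

/-- continuous dependence of regular solutions of the perturbed Bessel
equation on the potential, in the `L²` norm with respect to the spectral parameter:
there are constants `c_μ, C > 0`, depending only on `ℓ, μ, b`, such that for any two
potentials `q₁, q₂` with `x^μ q_i ∈ L¹(0,b)` and corresponding regular solutions
`y₁, y₂` (normalized by `y_i(ω,x)/x^{ℓ+1} → √π |ω|^{ℓ+1}/(2^{ℓ+1} Γ(ℓ+3/2))` as `x → 0⁺`),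
for every `x ∈ (0,b]`,
`‖y₁(·,x) - y₂(·,x)‖_{L²(ℝ)} ≤ c_μ C(q₁,x) C(q₂,x) ∫_0^x t^μ |q₁-q₂| dt`,
where `C(q,x) = C exp((C/b) ∫_0^x t|q(t)| dt)`. -/
theorem continuous_dependence_L2
    (b l μ : ℝ) (hb : 0 < b) (hl : -(1/2 : ℝ) < l) (hμ0 : 0 ≤ μ) (hμ : μ < 1/2) :
    ∃ cμ C : ℝ, 0 < cμ ∧ 0 < C ∧
      ∀ (q₁ q₂ : ℝ → ℂ) (y₁ y₂ : ℝ → ℝ → ℂ),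
        Measurable q₁ → Measurable q₂ →
        IntegrableOn (fun t : ℝ => t ^ μ * ‖q₁ t‖) (Set.Ioo 0 b) →
        IntegrableOn (fun t : ℝ => t ^ μ * ‖q₂ t‖) (Set.Ioo 0 b) →
        (∀ x ∈ Set.Ioc (0 : ℝ) b, Measurable fun ω : ℝ => y₁ ω x) →
        (∀ x ∈ Set.Ioc (0 : ℝ) b, Measurable fun ω : ℝ => y₂ ω x) →
        (∀ ω : ℝ, ∀ x ∈ Set.Ioc (0 : ℝ) b,
          DifferentiableAt ℝ (y₁ ω) x ∧ DifferentiableAt ℝ (deriv (y₁ ω)) x ∧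
          -deriv (deriv (y₁ ω)) x + ((l * (l + 1) / x ^ 2 : ℝ) : ℂ) * y₁ ω x +
              q₁ x * y₁ ω x = ((ω : ℂ)) ^ 2 * y₁ ω x) →
        (∀ ω : ℝ, ∀ x ∈ Set.Ioc (0 : ℝ) b,
          DifferentiableAt ℝ (y₂ ω) x ∧ DifferentiableAt ℝ (deriv (y₂ ω)) x ∧
          -deriv (deriv (y₂ ω)) x + ((l * (l + 1) / x ^ 2 : ℝ) : ℂ) * y₂ ω x +
              q₂ x * y₂ ω x = ((ω : ℂ)) ^ 2 * y₂ ω x) →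
        (∀ ω : ℝ, ω ≠ 0 →
          Filter.Tendsto (fun x : ℝ => y₁ ω x / ((x ^ (l + 1) : ℝ) : ℂ))
            (nhdsWithin 0 (Set.Ioi 0))
            (nhds ((Real.sqrt Real.pi * |ω| ^ (l + 1) /
              (2 ^ (l + 1) * Real.Gamma (l + 3 / 2)) : ℝ) : ℂ))) →
        (∀ ω : ℝ, ω ≠ 0 →
          Filter.Tendsto (fun x : ℝ => y₂ ω x / ((x ^ (l + 1) : ℝ) : ℂ))
            (nhdsWithin 0 (Set.Ioi 0))
            (nhds ((Real.sqrt Real.pi * |ω| ^ (l + 1) /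
              (2 ^ (l + 1) * Real.Gamma (l + 3 / 2)) : ℝ) : ℂ))) →
        ∀ x ∈ Set.Ioc (0 : ℝ) b,
          (∫⁻ ω : ℝ, (‖y₁ ω x - y₂ ω x‖₊ : ENNReal) ^ 2) ^ (1 / 2 : ℝ) ≤
            ENNReal.ofReal (cμ *
              (C * Real.exp ((C / b) * ∫ t in Set.Ioo (0 : ℝ) x, t * ‖q₁ t‖)) *
              (C * Real.exp ((C / b) * ∫ t in Set.Ioo (0 : ℝ) x, t * ‖q₂ t‖)) *
              ∫ t in Set.Ioo (0 : ℝ) x, t ^ μ * ‖q₁ t - q₂ t‖) := by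
  set c₀ : ℝ := Real.sqrt Real.pi / (2 ^ (l + 1) * Real.Gamma (l + 3 / 2)) with hc₀_def
  have hΓ : 0 < Real.Gamma (l + 3 / 2) := Real.Gamma_pos_of_pos (by linarith)
  have hc₀ : 0 < c₀ := by positivity
  obtain ⟨K, hK, hmain⟩ := exists_difference_bound (b := b) hl hμ0 hμ hc₀
  set W : ℝ := Real.sqrt (∫ ω : ℝ, (1 + ‖ω‖) ^ (-(2 * (1 - μ)))) with hW
  set M : ℝ := K ^ 2 * c₀ * (1 + b) ^ (1 - μ) * W with hM
  have hM0 : 0 ≤ M := by positivity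
  refine ⟨(M + 1) / (K * b) ^ 2, K * b, by positivity, by positivity, ?_⟩
  intro q₁ q₂ y₁ y₂ hm₁ hm₂ hq₁ hq₂ _ _ hy₁ hy₂ ht₁ ht₂ x hx
  have hode : ∀ {q : ℝ → ℂ} {y : ℝ → ℝ → ℂ} (ω : ℝ),
      (∀ x ∈ Ioc (0 : ℝ) b, DifferentiableAt ℝ (y ω) x ∧ DifferentiableAt ℝ (deriv (y ω)) x ∧
        -deriv (deriv (y ω)) x + ((l * (l + 1) / x ^ 2 : ℝ) : ℂ) * y ω x + q x * y ω x =
          (ω : ℂ) ^ 2 * y ω x) →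
      ∀ x ∈ Ioc (0 : ℝ) b, HasDerivAt (deriv (y ω))
        (((l * (l + 1) / x ^ 2 : ℝ) : ℂ) * y ω x + (q x - ((|ω| : ℝ) : ℂ) ^ 2) * y ω x) x := by
    intro q y ω h x hx
    obtain ⟨-, h2, h3⟩ := h x hx
    have hsq : ((|ω| : ℝ) : ℂ) ^ 2 = (ω : ℂ) ^ 2 := by exact_mod_cast sq_abs ω
    refine h2.hasDerivAt.congr_deriv ?_
    rw [hsq]
    linear_combination -h3
  set e₁ : ℝ := Real.exp (K * ∫ t in Ioo 0 x, t * ‖q₁ t‖) with he₁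
  set e₂ : ℝ := Real.exp (K * ∫ t in Ioo 0 x, t * ‖q₂ t‖) with he₂
  set J : ℝ := ∫ t in Ioo 0 x, t ^ μ * ‖q₁ t - q₂ t‖ with hJ
  have hJ0 : 0 ≤ J := setIntegral_nonneg measurableSet_Ioo fun t ht =>
    mul_nonneg (Real.rpow_nonneg ht.1.le _) (norm_nonneg _)
  have hbound : ∀ ω : ℝ, ω ≠ 0 →
      ‖y₁ ω x - y₂ ω x‖ ≤ (K ^ 2 * c₀ * e₁ * e₂ * J) * ((1 + b) / (1 + |ω|)) ^ (1 - μ) := by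
    intro ω hω
    refine hmain q₁ q₂ (y₁ ω) (y₂ ω) (deriv (y₁ ω)) (deriv (y₂ ω)) |ω| x _ hm₁ hm₂ hq₁ hq₂
      (fun t ht => (hy₁ ω t ht).1.hasDerivAt) (hode ω (hy₁ ω))
      (fun t ht => (hy₂ ω t ht).1.hasDerivAt) (hode ω (hy₂ ω)) (ht₁ ω hω) (ht₂ ω hω)
      (abs_pos.2 hω) ?_ hx
    rw [Complex.norm_real, Real.norm_of_nonneg (by positivity), hc₀_def]
    ring
  refine (lintegral_sq_rpow_half_le (g := fun ω => y₁ ω x - y₂ ω x) hb (by positivity) hμ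
    hbound).trans (ENNReal.ofReal_le_ofReal ?_)
  have hKb : K * b / b = K := mul_div_cancel_right₀ K hb.ne'
  rw [hKb, ← he₁, ← he₂]
  calc K ^ 2 * c₀ * e₁ * e₂ * J * (1 + b) ^ (1 - μ) * W = M * (e₁ * e₂ * J) := by rw [hM]; ring
    _ ≤ (M + 1) * (e₁ * e₂ * J) := by gcongr; linarith
    _ = _ := by field_simp
end

section
/- Let b > 0 and ℓ ≥ −1/2 be real, and let q : (0, b] → ℂ be measurable and satisfy: x q(x) ∈ L¹(0, b) if ℓ > −1/2, and x q(x)(1 − log(x/b)) ∈ L¹(0, b) if ℓ = −1/2. Then there exists λ₀ > 0 such that for every real λ > λ₀ the following holds: if u : (0, b] → ℂ is twice differentiable, satisfies −u″(x) + (ℓ(ℓ+1)/x² + q(x) + λ) u(x) = 0 for all x ∈ (0, b], and lim_{x→0+} u(x)/x^{ℓ+1} = c for some c ≠ 0, then u(x) ≠ 0 for all x ∈ (0, b]. -/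
open MeasureTheory Set Filter

/-- A nonnegative function `p` with `p' = r w`, where `w'` is bounded below by `-h p / ψ` for a weight
`ψ` with `ψ' = -r` blowing up at `0`, tends to `0` at `0⁺` as soon as `p` and `w` vanish at the right
endpoint and `∫ h < 1`. -/
theorem tendsto_nonpos_of_weighted_deriv_ge {X : ℝ} (hX : 0 < X) {p w w' ψ r h : ℝ → ℝ} {p₀ : ℝ}
    (hp : ∀ x ∈ Ioc 0 X, HasDerivAt p (r x * w x) x)
    (hw : ∀ x ∈ Ioc 0 X, HasDerivAt w (w' x) x)
    (hψ : ∀ x ∈ Ioc 0 X, HasDerivAt ψ (-r x) x)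
    (hr : ∀ x ∈ Ioc 0 X, 0 ≤ r x) (hψ0 : ∀ x ∈ Ioc 0 X, 0 < ψ x)
    (hh : ∀ x ∈ Ioc 0 X, 0 ≤ h x) (hp0 : ∀ x ∈ Ioc 0 X, 0 ≤ p x)
    (hle : ∀ x ∈ Ioc 0 X, -(h x * p x) ≤ ψ x * w' x)
    (hint : IntegrableOn h (Ioc 0 X)) (hlt : ∫ x in Ioc 0 X, h x < 1)
    (hpX : p X = 0) (hwX : w X = 0)
    (hψt : Tendsto ψ (nhdsWithin 0 (Ioi 0)) atTop)
    (hpt : Tendsto p (nhdsWithin 0 (Ioi 0)) (nhds p₀)) : p₀ ≤ 0 := by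
  have hbdd : BddAbove (p '' Ioc 0 X) := by
    obtain ⟨e, he, hsub⟩ := mem_nhdsGT_iff_exists_Ioo_subset.1
      (hpt.eventually (gt_mem_nhds (lt_add_one p₀)))
    have hcpt : BddAbove (p '' Icc e X) := isCompact_Icc.bddAbove_image fun x hx =>
      (hp x ⟨lt_of_lt_of_le he hx.1, hx.2⟩).continuousAt.continuousWithinAt
    obtain ⟨C, hC⟩ := hcpt
    refine ⟨max (p₀ + 1) C, ?_⟩
    rintro _ ⟨x, hx, rfl⟩
    rcases lt_or_ge x e with h1 | h1
    · exact le_max_of_le_left (le_of_lt (hsub ⟨hx.1, h1⟩))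
    · exact le_max_of_le_right (hC ⟨x, ⟨h1, hx.2⟩, rfl⟩)
  set M := sSup (p '' Ioc 0 X)
  set δ := ∫ x in Ioc 0 X, h x
  have hpM : ∀ x ∈ Ioc 0 X, p x ≤ M := fun x hx => le_csSup hbdd ⟨x, hx, rfl⟩
  have hXX : X ∈ Ioc 0 X := ⟨hX, le_rfl⟩
  have hM0 : 0 ≤ M := (hp0 X hXX).trans (hpM X hXX)
  have hf : ∀ x ∈ Ioc 0 X, p x + ψ x * w x ≤ M * δ := by
    intro x hx
    have hsub : Ioc x X ⊆ Ioc 0 X := Ioc_subset_Ioc_left hx.1.le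
    have hd : ∀ y ∈ Ioc 0 X,
        HasDerivAt (fun y => -(p y + ψ y * w y)) (-(ψ y * w' y)) y := fun y hy => by
      refine HasDerivAt.congr_deriv (((hp y hy).add ((hψ y hy).mul (hw y hy))).neg) ?_
      ring
    have key := intervalIntegral.sub_le_integral_of_hasDeriv_right_of_le (a := x) (b := X)
      (g := fun y => -(p y + ψ y * w y)) (g' := fun y => -(ψ y * w' y)) (φ := fun y => M * h y)
      hx.2
      (fun y hy => (hd y ⟨hx.1.trans_le hy.1, hy.2⟩).continuousAt.continuousWithinAt)
      (fun y hy => (hd y ⟨hx.1.trans hy.1, hy.2.le⟩).hasDerivWithinAt)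
      (by rw [integrableOn_Icc_iff_integrableOn_Ioc]; exact (hint.mono_set hsub).const_mul M)
      (fun y hy => by
        have hy' : y ∈ Ioc 0 X := ⟨hx.1.trans hy.1, hy.2.le⟩
        have := hle y hy'
        nlinarith [mul_le_mul_of_nonneg_left (hpM y hy') (hh y hy')])
    rw [intervalIntegral.integral_of_le hx.2, integral_const_mul] at key
    have hmono : ∫ y in Ioc x X, h y ≤ δ := setIntegral_mono_set hint
      ((ae_restrict_iff' measurableSet_Ioc).2 (Eventually.of_forall hh)) hsub.eventuallyLE
    have := mul_le_mul_of_nonneg_left hmono hM0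
    simp only [hpX, hwX] at key
    linarith
  have hpδ : ∀ x ∈ Ioc 0 X, p x ≤ M * δ := by
    have hd : ∀ y ∈ Ioc 0 X, HasDerivAt (fun y => (p y - M * δ) / ψ y)
        (r y * (p y + ψ y * w y - M * δ) / ψ y ^ 2) y := fun y hy => by
      refine HasDerivAt.congr_deriv
        (((hp y hy).sub_const (M * δ)).div (hψ y hy) (hψ0 y hy).ne') ?_
      ring
    have hanti : AntitoneOn (fun y => (p y - M * δ) / ψ y) (Ioc 0 X) := by
      refine antitoneOn_of_deriv_nonpos (convex_Ioc 0 X)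
        (fun y hy => (hd y hy).continuousAt.continuousWithinAt)
        (fun y hy => (hd y (interior_subset hy)).differentiableAt.differentiableWithinAt)
        (fun y hy => ?_)
      have hy' := interior_subset hy
      rw [(hd y hy').deriv]
      exact div_nonpos_of_nonpos_of_nonneg
        (mul_nonpos_of_nonneg_of_nonpos (hr y hy') (by linarith [hf y hy'])) (sq_nonneg _)
    have hlim : Tendsto (fun y => (p y - M * δ) / ψ y) (nhdsWithin 0 (Ioi 0)) (nhds 0) :=
      (hpt.sub_const (M * δ)).div_atTop hψt
    intro x hx
    have hx0 : (p x - M * δ) / ψ x ≤ 0 := by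
      refine ge_of_tendsto hlim ?_
      filter_upwards [Ioo_mem_nhdsGT hx.1] with y hy
      exact hanti ⟨hy.1, hy.2.le.trans hx.2⟩ hx hy.2.le
    have := (div_le_iff₀ (hψ0 x hx)).1 hx0
    linarith
  have hMδ : M ≤ M * δ := csSup_le ⟨_, X, hXX, rfl⟩ (by rintro _ ⟨x, hx, rfl⟩; exact hpδ x hx)
  have hMz : M ≤ 0 := by
    by_contra! hc
    nlinarith
  refine le_of_tendsto hpt ?_
  filter_upwards [Ioc_mem_nhdsGT hX] with x hx
  exact (hpM x hx).trans hMz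

/-- The truncations `(‖q‖ - λ)₊` of a weighted integrable function have small weighted integral. -/
theorem eventually_setIntegral_mul_max_sub_lt {s : Set ℝ} (hs : MeasurableSet s) {k : ℝ → ℝ}
    {q : ℝ → ℂ} (hkm : Measurable k) (hqm : Measurable q) (hk : ∀ x ∈ s, 0 ≤ k x)
    (hint : IntegrableOn (fun x => k x * ‖q x‖) s) {ε : ℝ} (hε : 0 < ε) :
    ∀ᶠ lam : ℝ in atTop, IntegrableOn (fun x => k x * max (‖q x‖ - lam) 0) s ∧
      ∫ x in s, k x * max (‖q x‖ - lam) 0 < ε := by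
  have hmeas : ∀ lam : ℝ, Measurable fun x => k x * max (‖q x‖ - lam) 0 := fun lam =>
    hkm.mul ((hqm.norm.sub_const lam).max measurable_const)
  have hbound : ∀ lam : ℝ, 0 ≤ lam → ∀ᵐ x ∂volume.restrict s,
      ‖k x * max (‖q x‖ - lam) 0‖ ≤ k x * ‖q x‖ := fun lam hlam => by
    refine (ae_restrict_iff' hs).2 (Eventually.of_forall fun x hx => ?_)
    rw [Real.norm_of_nonneg (mul_nonneg (hk x hx) (le_max_right _ _))]
    exact mul_le_mul_of_nonneg_left (max_le (by linarith) (norm_nonneg _)) (hk x hx)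
  have hlim : Tendsto (fun lam : ℝ => ∫ x in s, k x * max (‖q x‖ - lam) 0) atTop
      (nhds (∫ _ in s, (0 : ℝ))) := by
    refine tendsto_integral_filter_of_dominated_convergence (fun x => k x * ‖q x‖)
      (Eventually.of_forall fun lam => (hmeas lam).aestronglyMeasurable)
      ((eventually_ge_atTop 0).mono hbound) hint (Eventually.of_forall fun x => ?_)
    refine tendsto_const_nhds.congr' ?_
    filter_upwards [eventually_ge_atTop ‖q x‖] with lam hlam
    rw [max_eq_right (by linarith), mul_zero]
  rw [integral_zero] at hlim
  filter_upwards [eventually_ge_atTop 0, hlim.eventually (gt_mem_nhds hε)] with lam h0 h1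
  exact ⟨Integrable.mono' hint (hmeas lam).aestronglyMeasurable (hbound lam h0), h1⟩

/-- The derivative of `(|u|²)' - (2l+2)|u|²/x` for a solution of the perturbed Bessel equation,
in terms of the real and imaginary parts of `u`. -/
theorem hasDerivAt_bessel_flux {l lam x : ℝ} (hx : x ≠ 0) {u : ℝ → ℂ} {Q : ℂ}
    (hu : DifferentiableAt ℝ u x) (hu' : DifferentiableAt ℝ (deriv u) x)
    (hode : -deriv (deriv u) x +
      (((l * (l + 1) / x ^ 2 : ℝ) : ℂ) + Q + (lam : ℂ)) * u x = 0) :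
    HasDerivAt (fun y => 2 * ((u y).re * (deriv u y).re + (u y).im * (deriv u y).im) -
        (2 * l + 2) * Complex.normSq (u y) / y)
      (2 * (((deriv u x).re - (l + 1) * (u x).re / x) ^ 2 +
        ((deriv u x).im - (l + 1) * (u x).im / x) ^ 2) +
        2 * (Q.re + lam) * Complex.normSq (u x)) x := by
  have hre : HasDerivAt (fun y => (u y).re) (deriv u x).re x :=
    Complex.reCLM.hasFDerivAt.comp_hasDerivAt x hu.hasDerivAt
  have him : HasDerivAt (fun y => (u y).im) (deriv u x).im x :=
    Complex.imCLM.hasFDerivAt.comp_hasDerivAt x hu.hasDerivAt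
  have hre' : HasDerivAt (fun y => (deriv u y).re) (deriv (deriv u) x).re x :=
    Complex.reCLM.hasFDerivAt.comp_hasDerivAt x hu'.hasDerivAt
  have him' : HasDerivAt (fun y => (deriv u y).im) (deriv (deriv u) x).im x :=
    Complex.imCLM.hasFDerivAt.comp_hasDerivAt x hu'.hasDerivAt
  have hu2 : deriv (deriv u) x =
      (((l * (l + 1) / x ^ 2 : ℝ) : ℂ) + Q + (lam : ℂ)) * u x := by linear_combination -hode
  have h2re := congrArg Complex.re hu2
  have h2im := congrArg Complex.im hu2
  simp only [Complex.mul_re, Complex.mul_im, Complex.add_re, Complex.add_im, Complex.ofReal_re,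
    Complex.ofReal_im] at h2re h2im
  simp only [Complex.normSq_apply]
  refine HasDerivAt.congr_deriv ((((hre.mul hre').add (him.mul him')).const_mul 2).sub
    ((((hre.mul hre).add (him.mul him)).const_mul (2 * l + 2)).div (hasDerivAt_id x) hx)) ?_
  simp only [Pi.mul_apply, Pi.add_apply]
  rw [h2re, h2im]
  field_simp
  ring

/-- A regular solution does not vanish, provided that the part of `q` exceeding the shift is small
with respect to a weight `ψ` satisfying `ψ' = -x^{-(2l+2)}`. -/
theorem bessel_regular_solution_ne_zero {b l lam : ℝ} {q : ℝ → ℂ} {ψ : ℝ → ℝ}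
    (hψ : ∀ x ∈ Ioc 0 b, HasDerivAt ψ (-x ^ (-(2 * l + 2))) x)
    (hψ0 : ∀ x ∈ Ioc 0 b, 0 < ψ x) (hψt : Tendsto ψ (nhdsWithin 0 (Ioi 0)) atTop)
    (hint : IntegrableOn (fun x => ψ x * x ^ (2 * l + 2) * max (‖q x‖ - lam) 0) (Ioc 0 b))
    (hlt : ∫ x in Ioc 0 b, ψ x * x ^ (2 * l + 2) * max (‖q x‖ - lam) 0 < 1 / 2)
    {u : ℝ → ℂ} {c : ℂ} (hc : c ≠ 0)
    (hu : ∀ x ∈ Ioc 0 b, DifferentiableAt ℝ u x ∧ DifferentiableAt ℝ (deriv u) x)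
    (hode : ∀ x ∈ Ioc 0 b, -deriv (deriv u) x +
      (((l * (l + 1) / x ^ 2 : ℝ) : ℂ) + q x + (lam : ℂ)) * u x = 0)
    (hlim : Tendsto (fun x : ℝ => u x / ((x ^ (l + 1) : ℝ) : ℂ)) (nhdsWithin 0 (Ioi 0)) (nhds c))
    {X : ℝ} (hX : X ∈ Ioc 0 b) : u X ≠ 0 := by
  intro huX
  have hsub : Ioc 0 X ⊆ Ioc 0 b := Ioc_subset_Ioc_right hX.2
  set k : ℝ → ℝ := fun x => ψ x * x ^ (2 * l + 2) * max (‖q x‖ - lam) 0 with hk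
  have hk0 : ∀ x ∈ Ioc 0 b, 0 ≤ k x := fun x hx =>
    mul_nonneg (mul_nonneg (hψ0 x hx).le (Real.rpow_nonneg hx.1.le _)) (le_max_right _ _)
  have hkX : ∫ x in Ioc 0 X, 2 * k x < 1 := by
    have : ∫ x in Ioc 0 X, k x ≤ ∫ x in Ioc 0 b, k x := setIntegral_mono_set hint
      ((ae_restrict_iff' measurableSet_Ioc).2 (Eventually.of_forall hk0)) hsub.eventuallyLE
    rw [integral_const_mul]
    linarith
  have hcontra : Complex.normSq c ≤ 0 := by
    refine tendsto_nonpos_of_weighted_deriv_ge hX.1 (ψ := ψ) (h := fun x => 2 * k x)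
      (p := fun x => x ^ (-(2 * l + 2)) * Complex.normSq (u x))
      (r := fun x => x ^ (-(2 * l + 2)))
      (fun x hx => ?_)
      (fun x hx => hasDerivAt_bessel_flux hx.1.ne' (hu x (hsub hx)).1 (hu x (hsub hx)).2
        (hode x (hsub hx)))
      (fun x hx => hψ x (hsub hx)) (fun x hx => Real.rpow_nonneg hx.1.le _)
      (fun x hx => hψ0 x (hsub hx)) (fun x hx => mul_nonneg zero_le_two (hk0 x (hsub hx)))
      (fun x hx => mul_nonneg (Real.rpow_nonneg hx.1.le _) (Complex.normSq_nonneg _))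
      (fun x hx => ?_) ((hint.mono_set hsub).const_mul 2) hkX (by simp [huX]) (by simp [huX])
      hψt ?_
    · have hd := (hu x (hsub hx)).1.hasDerivAt
      have hre : HasDerivAt (fun y => (u y).re) (deriv u x).re x :=
        Complex.reCLM.hasFDerivAt.comp_hasDerivAt x hd
      have him : HasDerivAt (fun y => (u y).im) (deriv u x).im x :=
        Complex.imCLM.hasFDerivAt.comp_hasDerivAt x hd
      simp only [Complex.normSq_apply]
      refine HasDerivAt.congr_deriv
        ((Real.hasDerivAt_rpow_const (p := -(2 * l + 2)) (Or.inl hx.1.ne')).mul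
        ((hre.mul hre).add (him.mul him))) ?_
      rw [Real.rpow_sub_one hx.1.ne']
      have := hx.1.ne'
      field_simp
      ring
    · have hxp : x ^ (2 * l + 2) * x ^ (-(2 * l + 2)) = 1 := by
        rw [← Real.rpow_add hx.1, add_neg_cancel, Real.rpow_zero]
      have hle : -(max (‖q x‖ - lam) 0) ≤ (q x).re + lam := by
        have h1 := (abs_le.1 (Complex.abs_re_le_norm (q x))).1
        have h2 := le_max_left (‖q x‖ - lam) 0
        linarith
      have hN := mul_le_mul_of_nonneg_right hle (Complex.normSq_nonneg (u x))
      calc -(2 * k x * (x ^ (-(2 * l + 2)) * Complex.normSq (u x)))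
          = ψ x * (2 * (-(max (‖q x‖ - lam) 0) * Complex.normSq (u x))) := by
            simp only [hk]
            linear_combination
              (-2 * ψ x * max (‖q x‖ - lam) 0 * Complex.normSq (u x)) * hxp
        _ ≤ _ := by
            refine mul_le_mul_of_nonneg_left ?_ (hψ0 x (hsub hx)).le
            nlinarith [sq_nonneg ((deriv u x).re - (l + 1) * (u x).re / x),
              sq_nonneg ((deriv u x).im - (l + 1) * (u x).im / x)]
    · refine ((Complex.continuous_normSq.tendsto c).comp hlim).congr' ?_
      filter_upwards [self_mem_nhdsWithin] with x hx
      have hx0 : 0 < x := hx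
      rw [Function.comp_apply, Complex.normSq_div, Complex.normSq_ofReal, ← Real.rpow_add hx0,
        Real.rpow_neg hx0.le, div_eq_inv_mul]
      ring_nf
  exact hc (Complex.normSq_eq_zero.1 (le_antisymm hcontra (Complex.normSq_nonneg c)))

/-- existence of a spectral shift making the regular solution non-vanishing.
If `x q(x) ∈ L¹(0,b)` (for `ℓ > -1/2`; with the extra logarithmic factor for `ℓ = -1/2`),
then there is `λ₀ > 0` such that for every `λ > λ₀` any regular solution `u` of
`-u″ + (ℓ(ℓ+1)/x² + q + λ)u = 0` on `(0,b]` with `u(x)/x^{ℓ+1} → c ≠ 0` as `x → 0⁺`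
does not vanish on `(0,b]`. -/
theorem exists_shift_nonvanishing_regular_solution
    (b l : ℝ) (hb : 0 < b) (hl : -(1/2 : ℝ) ≤ l)
    (q : ℝ → ℂ) (hqm : Measurable q)
    (hq1 : -(1/2 : ℝ) < l → IntegrableOn (fun t : ℝ => t * ‖q t‖) (Set.Ioo 0 b))
    (hq2 : l = -(1/2 : ℝ) →
      IntegrableOn (fun t : ℝ => t * ‖q t‖ * (1 - Real.log (t / b))) (Set.Ioo 0 b)) :
    ∃ lam0 : ℝ, 0 < lam0 ∧ ∀ lam : ℝ, lam0 < lam →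
      ∀ (u : ℝ → ℂ) (c : ℂ), c ≠ 0 →
        (∀ x ∈ Set.Ioc (0 : ℝ) b,
          DifferentiableAt ℝ u x ∧ DifferentiableAt ℝ (deriv u) x) →
        (∀ x ∈ Set.Ioc (0 : ℝ) b,
          -deriv (deriv u) x +
            (((l * (l + 1) / x ^ 2 : ℝ) : ℂ) + q x + (lam : ℂ)) * u x = 0) →
        Filter.Tendsto (fun x : ℝ => u x / ((x ^ (l + 1) : ℝ) : ℂ))
          (nhdsWithin 0 (Set.Ioi 0)) (nhds c) →
        ∀ x ∈ Set.Ioc (0 : ℝ) b, u x ≠ 0 := by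
  obtain ⟨ψ, hψm, hψ, hψ0, hψt, hint⟩ : ∃ ψ : ℝ → ℝ, Measurable ψ ∧
      (∀ x ∈ Ioc 0 b, HasDerivAt ψ (-x ^ (-(2 * l + 2))) x) ∧ (∀ x ∈ Ioc 0 b, 0 < ψ x) ∧
      Tendsto ψ (nhdsWithin 0 (Ioi 0)) atTop ∧
      IntegrableOn (fun x => ψ x * x ^ (2 * l + 2) * ‖q x‖) (Ioc 0 b) := by
    rcases hl.eq_or_lt with rfl | hl'
    · refine ⟨fun x => 1 - Real.log (x / b), by fun_prop, fun x hx => ?_, fun x hx => ?_, ?_, ?_⟩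
      · refine HasDerivAt.congr_deriv
          ((((hasDerivAt_id x).div_const b).log (div_pos hx.1 hb).ne').const_sub 1) ?_
        have h1 : -(2 * -(1 / 2 : ℝ) + 2) = -1 := by norm_num
        have := hx.1.ne'
        simp only [h1, Real.rpow_neg_one, id]
        field_simp
      · have := Real.log_nonpos (div_nonneg hx.1.le hb.le) ((div_le_one hb).2 hx.2)
        linarith
      · have h1 : Tendsto (fun x : ℝ => x / b) (nhdsWithin 0 (Ioi 0)) (nhdsWithin 0 (Ioi 0)) := by
          refine tendsto_nhdsWithin_iff.2 ⟨?_, ?_⟩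
          · have : Tendsto (fun x : ℝ => x / b) (nhds 0) (nhds (0 / b)) :=
              (continuous_id.div_const b).tendsto 0
            rw [zero_div] at this
            exact this.mono_left nhdsWithin_le_nhds
          · filter_upwards [self_mem_nhdsWithin] with x hx using div_pos hx hb
        have h2 := tendsto_neg_atBot_atTop.comp (Real.tendsto_log_nhdsGT_zero.comp h1)
        exact (tendsto_atTop_add_const_left _ 1 h2).congr fun x => by
          simp [Function.comp, sub_eq_add_neg]
      · rw [integrableOn_Ioc_iff_integrableOn_Ioo]
        refine (hq2 rfl).congr_fun (fun x _ => ?_) measurableSet_Ioo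
        have h1 : 2 * -(1 / 2 : ℝ) + 2 = 1 := by norm_num
        simp only [h1, Real.rpow_one]
        ring
    · have hm : 0 < 2 * l + 1 := by linarith
      refine ⟨fun x => x ^ (-(2 * l + 1)) / (2 * l + 1), by fun_prop, fun x hx => ?_,
        fun x hx => div_pos (Real.rpow_pos_of_pos hx.1 _) hm, ?_, ?_⟩
      · refine HasDerivAt.congr_deriv
          ((Real.hasDerivAt_rpow_const (p := -(2 * l + 1)) (Or.inl hx.1.ne')).div_const
          (2 * l + 1)) ?_
        rw [show -(2 * l + 1) - 1 = -(2 * l + 2) by ring]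
        field_simp
      · exact (tendsto_rpow_neg_nhdsGT_zero (neg_lt_zero.2 hm)).atTop_div_const hm
      · rw [integrableOn_Ioc_iff_integrableOn_Ioo]
        refine IntegrableOn.congr_fun ((hq1 hl').div_const (2 * l + 1)) (fun x hx => ?_)
          measurableSet_Ioo
        have h1 : x ^ (-(2 * l + 1)) * x ^ (2 * l + 2) = x := by
          rw [← Real.rpow_add hx.1, show -(2 * l + 1) + (2 * l + 2) = 1 by ring, Real.rpow_one]
        simp only
        linear_combination (-(‖q x‖ / (2 * l + 1))) * h1
  obtain ⟨N, hN⟩ := eventually_atTop.1 (eventually_setIntegral_mul_max_sub_lt measurableSet_Ioc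
    (hψm.mul (by fun_prop : Measurable fun x : ℝ => x ^ (2 * l + 2))) hqm
    (fun x hx => mul_nonneg (hψ0 x hx).le (Real.rpow_nonneg hx.1.le _)) hint one_half_pos)
  refine ⟨max N 1, by positivity, fun lam hlam u c hc hu hode hlim x hx => ?_⟩
  obtain ⟨hint', hlt⟩ := hN lam ((le_max_left N 1).trans hlam.le)
  exact bessel_regular_solution_ne_zero hψ hψ0 hψt hint' hlt hc hu hode hlim hx
end
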